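/- Let u be a smooth solution of (−Δ)^{3/2}u = 2e^{3u} with finite volume. Then there exists a constant a ≥ 0 such that for every x ∈ ℝ³ one has −Δu(x) = (1/π²)∫_{ℝ³} e^{3u(y)}/|x−y|² dy + a. -/

import Mathlib

open MeasureTheory Real Filter

noncomputable section

abbrev E3 := EuclideanSpace ℝ (Fin 3)

/-- The Laplacian of `f : ℝ³ → ℝ` as the sum of second partial derivatives. -/
def lap (f : E3 → ℝ) (x : E3) : ℝ :=
  ∑ i, fderiv ℝ (fun y => fderiv ℝ f y (EuclideanSpace.single i 1)) x (EuclideanSpace.single i 1)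

/-- The half Laplacian `(-Δ)^{1/2} φ` of a Schwartz function on ℝ³, defined as a
principal value: `(1/π²) lim_{ε→0⁺} ∫_{|x−y|>ε} (φ(x)−φ(y))/|x−y|⁴ dy`. -/
def halfLap (φ : SchwartzMap E3 ℝ) (x : E3) : ℝ :=
  limUnder (nhdsWithin (0:ℝ) (Set.Ioi 0)) fun ε =>
    (1 / π ^ 2) * ∫ y in {y : E3 | ε < ‖x - y‖}, (φ x - φ y) / ‖x - y‖ ^ 4

/-- `w ∈ L_{1/2}(ℝ³)`. -/
def MemL12 (w : E3 → ℝ) : Prop :=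
  LocallyIntegrable w volume ∧ Integrable (fun x => |w x| / (1 + ‖x‖ ^ 4)) volume

/-- `u` is a smooth solution of `(-Δ)^{3/2} u = 2 e^{3u}` in ℝ³ with finite volume. -/
def IsSolution (u : E3 → ℝ) : Prop :=
  ContDiff ℝ (⊤ : ℕ∞) u ∧ MemL12 (lap u) ∧ Integrable (fun x => exp (3 * u x)) volume ∧
    ∀ φ : SchwartzMap E3 ℝ,
      ∫ x, (-(lap u x)) * halfLap φ x = 2 * ∫ x, exp (3 * u x) * φ x

/-- `u` is a spherical solution. -/
def IsSpherical (u : E3 → ℝ) : Prop :=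
  ∃ lam : ℝ, 0 < lam ∧ ∃ x₀ : E3, ∀ x, u x = log (2 * lam / (1 + lam ^ 2 * ‖x - x₀‖ ^ 2))

/-- `α = (1/π²) ∫ e^{3u}`. -/
def solAlpha (u : E3 → ℝ) : ℝ := (1 / π ^ 2) * ∫ y, exp (3 * u y)

/-- `v(x) = (1/π²) ∫ log(|y|/|x−y|) e^{3u(y)} dy`. -/
def solV (u : E3 → ℝ) (x : E3) : ℝ :=
  (1 / π ^ 2) * ∫ y, log (‖y‖ / ‖x - y‖) * exp (3 * u y)

end

/-- The Gaussian profile `r ^ (-3/2) * exp (-c / r)`, with `c` in the role of `‖x‖²`. -/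
noncomputable def gaussProfile (c r : ℝ) : ℝ := r ^ (-(3 / 2) : ℝ) * exp (-(c / r))

/-- Minus the derivative of `gaussProfile c` in the time variable. -/
noncomputable def gaussProfileDecay (c r : ℝ) : ℝ :=
  (3 / 2 * r ^ (-(5 / 2) : ℝ) - c * r ^ (-(7 / 2) : ℝ)) * exp (-(c / r))

theorem hasDerivAt_gaussProfile (c : ℝ) {r : ℝ} (hr : 0 < r) :
    HasDerivAt (gaussProfile c) (-gaussProfileDecay c r) r := by
  have h1 : HasDerivAt (fun r : ℝ => r ^ (-(3 / 2) : ℝ)) (-(3/2) * r ^ (-(3/2) - 1 : ℝ)) r :=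
    Real.hasDerivAt_rpow_const (Or.inl hr.ne')
  have h2 : HasDerivAt (fun r : ℝ => exp (-(c / r))) (exp (-(c / r)) * (c / r ^ 2)) r := by
    have := ((hasDerivAt_inv hr.ne').const_mul c).neg.exp
    simp only [← div_eq_mul_inv] at this
    refine this.congr_deriv ?_
    simp only [Pi.neg_apply]
    ring
  have h := h1.mul h2
  have e : r ^ (-(7 / 2) : ℝ) = r ^ (-(3 / 2) : ℝ) / r ^ 2 := by
    rw [← Real.rpow_natCast, ← Real.rpow_sub hr]; norm_num
  refine HasDerivAt.congr_deriv (f := gaussProfile c) h ?_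
  rw [gaussProfileDecay, e]
  norm_num
  ring

theorem hasDerivAt_gaussProfileDecay_left (c : ℝ) {r : ℝ} (hr : 0 < r) :
    HasDerivAt (fun c => gaussProfileDecay c r)
      ((c * r ^ (-(9 / 2) : ℝ) - 5 / 2 * r ^ (-(7 / 2) : ℝ)) * exp (-(c / r))) c := by
  have h2 : HasDerivAt (fun c : ℝ => exp (-(c / r))) (exp (-(c / r)) * (-(1 / r))) c :=
    ((hasDerivAt_id c).div_const r).neg.exp
  have h1 : HasDerivAt (fun c : ℝ => 3 / 2 * r ^ (-(5 / 2) : ℝ) - c * r ^ (-(7 / 2) : ℝ))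
      (-(1 * r ^ (-(7 / 2) : ℝ))) c := ((hasDerivAt_id c).mul_const _).const_sub _
  have h := h1.mul h2
  have e : r ^ (-(7 / 2) : ℝ) = r ^ (-(5 / 2) : ℝ) / r := by
    rw [← Real.rpow_sub_one hr.ne']; norm_num
  have e' : r ^ (-(9 / 2) : ℝ) = r ^ (-(5 / 2) : ℝ) / r / r := by
    rw [← e, ← Real.rpow_sub_one hr.ne']; norm_num
  refine HasDerivAt.congr_deriv (f := fun c => gaussProfileDecay c r) h ?_
  rw [e', e]
  ring

theorem exists_rpow_mul_pow_mul_exp_le (α : ℝ) (j : ℕ) : ∃ C : ℝ, 0 < C ∧ ∀ r c : ℝ, 0 < r → 0 ≤ c →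
    r ^ (-α) * (c / r) ^ j * exp (-(c / r)) ≤ C * (r + c) ^ (-α) := by
  obtain ⟨N, hN⟩ := exists_nat_ge α
  refine ⟨(j + N).factorial * exp 1, by positivity, fun r c hr hc => ?_⟩
  set y := c / r with hy
  have hy0 : 0 ≤ y := by positivity
  have e : r + c = r * (1 + y) := by rw [hy]; field_simp
  rw [e, Real.mul_rpow hr.le (by positivity)]
  have h1 : (1 + y) ^ (j + N) ≤ (j + N).factorial * exp (1 + y) := by
    have := Real.pow_div_factorial_le_exp (1 + y) (by positivity) (j + N)
    rwa [div_le_iff₀' (by positivity)] at this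
  have h2 : (1 + y) ^ α ≤ (1 + y) ^ N := by
    rw [← Real.rpow_natCast]; exact Real.rpow_le_rpow_of_exponent_le (by linarith) hN
  have h3 : y ^ j * (1 + y) ^ α ≤ (j + N).factorial * exp (1 + y) := by
    refine le_trans ?_ h1
    rw [pow_add]; gcongr; linarith
  have h4 : y ^ j * exp (-y) ≤ (j + N).factorial * exp 1 * (1 + y) ^ (-α) := by
    rw [Real.rpow_neg (by positivity), ← div_eq_mul_inv, le_div_iff₀ (by positivity)]
    calc y ^ j * exp (-y) * (1 + y) ^ α = y ^ j * (1 + y) ^ α * exp (-y) := by ring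
      _ ≤ (j + N).factorial * exp (1 + y) * exp (-y) := by gcongr
      _ = _ := by rw [mul_assoc, ← exp_add]; ring_nf
  calc _ = r ^ (-α) * (y ^ j * exp (-y)) := by ring
    _ ≤ r ^ (-α) * _ := mul_le_mul_of_nonneg_left h4 (by positivity)
    _ = _ := by ring

theorem gaussProfile_nonneg (c : ℝ) {r : ℝ} (hr : 0 ≤ r) : 0 ≤ gaussProfile c r := by
  unfold gaussProfile; positivity

theorem exists_gaussProfile_le : ∃ C : ℝ, 0 < C ∧ ∀ r c : ℝ, 0 < r → 0 ≤ c →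
    gaussProfile c r ≤ C * (r + c) ^ (-(3 / 2) : ℝ) := by
  obtain ⟨C, hC, h⟩ := exists_rpow_mul_pow_mul_exp_le (3 / 2) 0
  exact ⟨C, hC, fun r c hr hc => by simpa [gaussProfile] using h r c hr hc⟩

theorem exists_abs_gaussProfileDecay_le : ∃ C : ℝ, 0 < C ∧ ∀ r c : ℝ, 0 < r → 0 ≤ c →
    |gaussProfileDecay c r| ≤ C * (r + c) ^ (-(5 / 2) : ℝ) := by
  obtain ⟨C, hC, h⟩ := exists_rpow_mul_pow_mul_exp_le (5 / 2) 0
  obtain ⟨D, hD, h'⟩ := exists_rpow_mul_pow_mul_exp_le (5 / 2) 1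
  refine ⟨3 / 2 * C + D, by positivity, fun r c hr hc => ?_⟩
  have e : r ^ (-(7 / 2) : ℝ) = r ^ (-(5 / 2) : ℝ) / r := by
    rw [← Real.rpow_sub_one hr.ne']; norm_num
  have a1 := h r c hr hc
  have a2 := h' r c hr hc
  have p1 : 0 ≤ r ^ (-(5 / 2) : ℝ) * exp (-(c / r)) := by positivity
  have p2 : 0 ≤ r ^ (-(5 / 2) : ℝ) * (c / r) * exp (-(c / r)) := by positivity
  have e2 : gaussProfileDecay c r = 3 / 2 * (r ^ (-(5 / 2) : ℝ) * exp (-(c / r)))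
      - r ^ (-(5 / 2) : ℝ) * (c / r) * exp (-(c / r)) := by
    rw [gaussProfileDecay, e]; ring
  simp only [pow_zero, mul_one, pow_one] at a1 a2
  rw [e2, abs_le]
  constructor <;> linarith

theorem exists_abs_gaussProfileDecay_sub_le : ∃ C : ℝ, 0 < C ∧ ∀ r m c d : ℝ, 0 < r →
    0 ≤ c → 0 ≤ d → 0 < m → m ≤ r + c → m ≤ r + d →
    |gaussProfileDecay c r - gaussProfileDecay d r| ≤ C * |c - d| * m ^ (-(7 / 2) : ℝ) := by
  obtain ⟨C, hC, h⟩ := exists_rpow_mul_pow_mul_exp_le (7 / 2) 0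
  obtain ⟨D, hD, h'⟩ := exists_rpow_mul_pow_mul_exp_le (7 / 2) 1
  refine ⟨5 / 2 * C + D, by positivity, fun r m c d hr hc hd hm hmc hmd => ?_⟩
  have key : ∀ x ∈ Set.Ici (0:ℝ) ∩ Set.Ici (m - r),
      ‖(x * r ^ (-(9 / 2) : ℝ) - 5 / 2 * r ^ (-(7 / 2) : ℝ)) * exp (-(x / r))‖ ≤
        (5 / 2 * C + D) * m ^ (-(7 / 2) : ℝ) := by
    rintro x ⟨hx : 0 ≤ x, hx' : m - r ≤ x⟩
    have e : r ^ (-(9 / 2) : ℝ) = r ^ (-(7 / 2) : ℝ) / r := by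
      rw [← Real.rpow_sub_one hr.ne']; norm_num
    have a1 := h r x hr hx
    have a2 := h' r x hr hx
    have p1 : 0 ≤ r ^ (-(7 / 2) : ℝ) * exp (-(x / r)) := by positivity
    have p2 : 0 ≤ r ^ (-(7 / 2) : ℝ) * (x / r) * exp (-(x / r)) := by positivity
    have p3 : (r + x) ^ (-(7 / 2) : ℝ) ≤ m ^ (-(7 / 2) : ℝ) :=
      Real.rpow_le_rpow_of_nonpos hm (by linarith) (by norm_num)
    have e2 : (x * r ^ (-(9 / 2) : ℝ) - 5 / 2 * r ^ (-(7 / 2) : ℝ)) * exp (-(x / r)) =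
        r ^ (-(7 / 2) : ℝ) * (x / r) * exp (-(x / r))
        - 5 / 2 * (r ^ (-(7 / 2) : ℝ) * exp (-(x / r))) := by
      rw [e]; ring
    simp only [pow_zero, mul_one, pow_one] at a1 a2
    have q1 := mul_le_mul_of_nonneg_left p3 hC.le
    have q2 := mul_le_mul_of_nonneg_left p3 hD.le
    rw [e2, Real.norm_eq_abs, abs_le]
    constructor <;> linarith
  have := ((convex_Ici (0:ℝ)).inter (convex_Ici (m - r))).norm_image_sub_le_of_norm_hasDerivWithin_le
    (fun x _ => (hasDerivAt_gaussProfileDecay_left x hr).hasDerivWithinAt) key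
    (show d ∈ _ from ⟨hd, by simp; linarith⟩) (show c ∈ _ from ⟨hc, by simp; linarith⟩)
  simp only [Real.norm_eq_abs] at this
  linarith

theorem integrable_inv_add_sq {M : ℝ} (hM : 0 < M) : Integrable fun a : ℝ => (M + a ^ 2)⁻¹ := by
  have h := (integrable_inv_one_add_sq.comp_mul_right' (R := (√M)⁻¹) (by positivity)).const_mul M⁻¹
  refine h.congr (Eventually.of_forall fun a => ?_)
  have : √M ^ 2 = M := Real.sq_sqrt hM.le
  simp only [mul_pow, inv_pow, this, ← mul_inv]
  congr 1
  field_simp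

theorem integral_inv_add_sq {M : ℝ} (hM : 0 < M) :
    ∫ a : ℝ, (M + a ^ 2)⁻¹ = π * M ^ (-(1 / 2) : ℝ) := by
  have h := Measure.integral_comp_mul_right (fun a : ℝ => (1 + a ^ 2)⁻¹) (√M)⁻¹
  have e : ∀ a : ℝ, (M + a ^ 2)⁻¹ = M⁻¹ * (1 + (a * (√M)⁻¹) ^ 2)⁻¹ := fun a => by
    have : √M ^ 2 = M := Real.sq_sqrt hM.le
    simp only [mul_pow, inv_pow, this, ← mul_inv]
    congr 1
    field_simp
  simp_rw [e, integral_const_mul, h, integral_univ_inv_one_add_sq]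
  rw [inv_inv, abs_of_nonneg (Real.sqrt_nonneg M), Real.sqrt_eq_rpow, smul_eq_mul,
    ← Real.rpow_neg_one, ← mul_assoc, ← Real.rpow_add hM, mul_comm]
  norm_num

theorem add_sq_rpow_le {M α : ℝ} (hM : 0 < M) (hα : 0 ≤ α) (a : ℝ) :
    (M + a ^ 2) ^ (-(α + 1)) ≤ M ^ (-α) * (M + a ^ 2)⁻¹ := by
  have h : 0 < M + a ^ 2 := by positivity
  rw [neg_add, ← sub_eq_add_neg, Real.rpow_sub_one h.ne', div_eq_mul_inv]
  gcongr ?_ * _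
  exact Real.rpow_le_rpow_of_nonpos hM (by nlinarith) (by linarith)

theorem integrable_add_sq_rpow {M α : ℝ} (hM : 0 < M) (hα : 0 ≤ α) :
    Integrable fun a : ℝ => (M + a ^ 2) ^ (-(α + 1)) := by
  refine ((integrable_inv_add_sq hM).const_mul (M ^ (-α))).mono' ?_ ?_
  · exact (Measurable.pow_const (by fun_prop) _).aestronglyMeasurable
  · refine Eventually.of_forall fun a => ?_
    rw [Real.norm_of_nonneg (by positivity)]
    exact add_sq_rpow_le hM hα a

theorem integral_add_sq_rpow_le {M α : ℝ} (hM : 0 < M) (hα : 0 ≤ α) :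
    ∫ a : ℝ, (M + a ^ 2) ^ (-(α + 1)) ≤ π * M ^ (-(α + 1 / 2)) := by
  refine (integral_mono (integrable_add_sq_rpow hM hα)
    ((integrable_inv_add_sq hM).const_mul (M ^ (-α))) (add_sq_rpow_le hM hα)).trans_eq ?_
  rw [integral_const_mul, integral_inv_add_sq hM, mul_left_comm, ← Real.rpow_add hM, neg_add]

theorem measurable_gaussProfile : Measurable fun p : ℝ × ℝ => gaussProfile p.1 p.2 := by
  unfold gaussProfile
  exact (measurable_snd.pow_const _).mul (by fun_prop)

theorem measurable_gaussProfileDecay : Measurable fun p : ℝ × ℝ => gaussProfileDecay p.1 p.2 := by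
  unfold gaussProfileDecay
  exact (((measurable_snd.pow_const _).const_mul _).sub
    (measurable_fst.mul (measurable_snd.pow_const _))).mul (by fun_prop)

theorem gaussProfile_le {c r : ℝ} (hc : 0 ≤ c) (hr : 0 < r) :
    gaussProfile c r ≤ r ^ (-(3 / 2) : ℝ) := by
  unfold gaussProfile
  refine mul_le_of_le_one_right (by positivity) (Real.exp_le_one_iff.2 ?_)
  have : 0 ≤ c / r := by positivity
  linarith

theorem exists_abs_gaussProfile_sub_le {c r : ℝ} (hc : 0 ≤ c) (hr : 0 < r) : ∃ K : ℝ, 0 < K ∧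
    ∀ a : ℝ, |gaussProfile c r - gaussProfile c (r + a ^ 2)| ≤ K * (a ^ 2 * (1 + a ^ 2)⁻¹) := by
  obtain ⟨C, hC, h⟩ := exists_abs_gaussProfileDecay_le
  set A := C * r ^ (-(5 / 2) : ℝ) with hA
  set B := r ^ (-(3 / 2) : ℝ) with hB
  have hA0 : 0 < A := by positivity
  have hB0 : 0 < B := by positivity
  refine ⟨A + B, by positivity, fun a => ?_⟩
  have hra : 0 < r + a ^ 2 := by positivity
  have h1 : |gaussProfile c r - gaussProfile c (r + a ^ 2)| ≤ A * a ^ 2 := by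
    have := (convex_Ici r).norm_image_sub_le_of_norm_hasDerivWithin_le (C := A)
      (fun x (hx : r ≤ x) => (hasDerivAt_gaussProfile c (hr.trans_le hx)).hasDerivWithinAt)
      (fun x (hx : r ≤ x) => by
        rw [norm_neg, Real.norm_eq_abs]
        refine (h x c (hr.trans_le hx) hc).trans ?_
        rw [hA]
        gcongr ?_ * ?_
        exact Real.rpow_le_rpow_of_nonpos hr (by linarith) (by norm_num))
      (show r + a ^ 2 ∈ Set.Ici r by simp; positivity) (show r ∈ Set.Ici r by simp)
    simpa [Real.norm_eq_abs, abs_of_nonneg (sq_nonneg a)] using this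
  have h2 : |gaussProfile c r - gaussProfile c (r + a ^ 2)| ≤ B := by
    have p1 := gaussProfile_nonneg c hr.le
    have p2 := gaussProfile_nonneg c hra.le
    have p3 := gaussProfile_le hc hr
    have p4 := gaussProfile_le hc hra
    have p5 : (r + a ^ 2) ^ (-(3 / 2) : ℝ) ≤ B :=
      Real.rpow_le_rpow_of_nonpos hr (by nlinarith) (by norm_num)
    rw [abs_le]
    constructor <;> linarith
  rw [← div_eq_mul_inv, ← mul_div_assoc, le_div_iff₀ (by positivity)]
  nlinarith [mul_le_mul_of_nonneg_right h2 (sq_nonneg a)]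

theorem integrable_gaussProfileDecay_add_sq {c r : ℝ} (hc : 0 ≤ c) (hr : 0 < r) :
    Integrable fun b : ℝ => gaussProfileDecay c (r + b ^ 2) := by
  obtain ⟨C, hC, h⟩ := exists_abs_gaussProfileDecay_le
  refine ((integrable_add_sq_rpow (M := r + c) (α := 3 / 2) (by positivity)
    (by norm_num)).const_mul C).mono' ?_ (Eventually.of_forall fun b => ?_)
  · exact (measurable_gaussProfileDecay.comp
      (by fun_prop : Measurable fun b : ℝ => (c, r + b ^ 2))).aestronglyMeasurable
  · have := h (r + b ^ 2) c (by positivity) hc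
    rw [Real.norm_eq_abs]
    convert this using 3
    · ring
    · norm_num

theorem integral_gaussProfile_sub_div_sq {c r : ℝ} (hc : 0 ≤ c) (hr : 0 < r) :
    ∫ a in Set.Ioi (0:ℝ), (gaussProfile c r - gaussProfile c (r + a ^ 2)) / a ^ 2 =
      ∫ b : ℝ, gaussProfileDecay c (r + b ^ 2) := by
  obtain ⟨K, hK, h⟩ := exists_abs_gaussProfile_sub_le hc hr
  set F : ℝ → ℝ := fun a => -((gaussProfile c r - gaussProfile c (r + a ^ 2)) / a) with hF
  have hbound : ∀ a, |F a| ≤ K * (|a| * (1 + a ^ 2)⁻¹) := fun a => by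
    rcases eq_or_ne a 0 with rfl | ha
    · simp [hF]
    · simp only [hF, abs_neg, abs_div]
      rw [div_le_iff₀ (abs_pos.2 ha)]
      refine (h a).trans_eq ?_
      rw [← sq_abs a]; ring
  have hderiv : ∀ a ∈ Set.Ioi (0:ℝ), HasDerivAt F
      ((gaussProfile c r - gaussProfile c (r + a ^ 2)) / a ^ 2
        - 2 * gaussProfileDecay c (r + a ^ 2)) a := by
    intro a ha
    have ha : 0 < a := ha
    have h1 : HasDerivAt (fun a : ℝ => r + a ^ 2) (2 * a) a := by
      simpa using (hasDerivAt_pow 2 a).const_add r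
    have h2 := (hasDerivAt_gaussProfile c (show 0 < r + a ^ 2 by positivity)).comp a h1
    have h3 := ((h2.const_sub (gaussProfile c r)).div (hasDerivAt_id a) ha.ne').neg
    refine HasDerivAt.congr_deriv (f := F) h3 ?_
    simp only [Function.comp_apply, id]
    field_simp
    ring
  have hdec := integrable_gaussProfileDecay_add_sq hc hr
  have hint1 : IntegrableOn
      (fun a => (gaussProfile c r - gaussProfile c (r + a ^ 2)) / a ^ 2) (Set.Ioi (0:ℝ)) := by
    refine Integrable.integrableOn ?_
    refine (integrable_inv_one_add_sq.const_mul K).mono' ?_ (Eventually.of_forall fun a => ?_)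
    · refine Measurable.aestronglyMeasurable ?_
      refine Measurable.div (measurable_const.sub ?_) (by fun_prop)
      exact measurable_gaussProfile.comp (by fun_prop : Measurable fun a : ℝ => (c, r + a ^ 2))
    · rcases eq_or_ne a 0 with rfl | ha
      · simp [hK.le]
      · rw [Real.norm_eq_abs, abs_div, abs_of_nonneg (sq_nonneg a), div_le_iff₀ (by positivity)]
        exact (h a).trans_eq (by ring)
  have hint2 : IntegrableOn (fun a => 2 * gaussProfileDecay c (r + a ^ 2)) (Set.Ioi (0:ℝ)) :=
    (hdec.const_mul 2).integrableOn
  have h0 : ContinuousWithinAt F (Set.Ici 0) 0 := by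
    have hF0 : F 0 = 0 := by simp [hF]
    refine ContinuousAt.continuousWithinAt ?_
    rw [ContinuousAt, hF0]
    refine squeeze_zero_norm (fun a => hbound a) ?_
    have : Continuous fun a : ℝ => K * (|a| * (1 + a ^ 2)⁻¹) := by
      refine continuous_const.mul (continuous_abs.mul (Continuous.inv₀ (by fun_prop) ?_))
      intro a; positivity
    simpa using this.tendsto 0
  have htop : Tendsto F atTop (nhds 0) := by
    refine squeeze_zero_norm' (a := fun a : ℝ => K * a⁻¹) ?_ ?_
    · filter_upwards [eventually_gt_atTop 0] with a ha
      refine (hbound a).trans ?_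
      gcongr
      rw [abs_of_pos ha, ← div_eq_mul_inv, div_le_iff₀ (by positivity)]
      field_simp; linarith
    · simpa using tendsto_inv_atTop_zero.const_mul K
  have key := integral_Ioi_of_hasDerivAt_of_tendsto h0 hderiv (hint1.sub hint2) htop
  rw [integral_sub hint1 hint2, integral_const_mul] at key
  have h2 := integral_comp_abs (f := fun b => gaussProfileDecay c (r + b ^ 2))
  simp only [sq_abs] at h2
  rw [h2]
  simp [hF] at key
  linarith

theorem integral_integral_gaussProfileDecay {c s : ℝ} (hc : 0 ≤ c) (hs : 0 < s) :
    ∫ a : ℝ, ∫ b : ℝ, gaussProfileDecay c (s + a ^ 2 + b ^ 2) = π * gaussProfile c s := by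
  obtain ⟨C, hC, h⟩ := exists_abs_gaussProfileDecay_le
  have hInt : Integrable (fun p : ℝ × ℝ => gaussProfileDecay c (s + p.1 ^ 2 + p.2 ^ 2))
      (volume.prod volume) := by
    refine (((integrable_inv_add_sq hs).mul_prod (integrable_inv_add_sq hs)).const_mul
      (C * s ^ (-(1 / 2) : ℝ))).mono' ?_ (Eventually.of_forall fun p => ?_)
    · exact (measurable_gaussProfileDecay.comp
        (by fun_prop : Measurable fun p : ℝ × ℝ => (c, s + p.1 ^ 2 + p.2 ^ 2))).aestronglyMeasurable
    · have hp : 0 < s + p.1 ^ 2 + p.2 ^ 2 := by positivity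
      refine (h _ c hp hc).trans ?_
      rw [mul_assoc]
      gcongr
      have e1 : (s + p.1 ^ 2 + p.2 ^ 2 + c) ^ (-(5 / 2) : ℝ)
          ≤ (s + p.1 ^ 2 + p.2 ^ 2) ^ (-(5 / 2) : ℝ) :=
        Real.rpow_le_rpow_of_nonpos hp (by linarith) (by norm_num)
      refine e1.trans ?_
      have e2 : (s + p.1 ^ 2 + p.2 ^ 2) ^ (-(5 / 2) : ℝ) =
          (s + p.1 ^ 2 + p.2 ^ 2) ^ (-(1 / 2) : ℝ) * ((s + p.1 ^ 2 + p.2 ^ 2) ^ 2)⁻¹ := by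
        rw [← Real.rpow_natCast (s + p.1 ^ 2 + p.2 ^ 2) 2, ← Real.rpow_neg hp.le,
          ← Real.rpow_add hp]
        norm_num
      rw [e2, ← mul_inv]
      gcongr ?_ * ?_
      · exact Real.rpow_le_rpow_of_nonpos hs (by nlinarith [sq_nonneg p.1, sq_nonneg p.2])
          (by norm_num)
      · gcongr
        nlinarith [mul_nonneg (sq_nonneg p.1) (sq_nonneg p.2), sq_nonneg p.1, sq_nonneg p.2,
          mul_nonneg hs.le (sq_nonneg p.1), mul_nonneg hs.le (sq_nonneg p.2),
          sq_nonneg (p.1 ^ 2 ), sq_nonneg (p.2 ^ 2)]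
  rw [← integral_prod (fun p : ℝ × ℝ => gaussProfileDecay c (s + p.1 ^ 2 + p.2 ^ 2)) hInt,
    ← Measure.volume_eq_prod, ← integral_comp_polarCoord_symm, polarCoord_target,
    Measure.volume_eq_prod]
  have e : ∀ p : ℝ × ℝ, p.1 • gaussProfileDecay c
      (s + (polarCoord.symm p).1 ^ 2 + (polarCoord.symm p).2 ^ 2) =
      (p.1 * gaussProfileDecay c (s + p.1 ^ 2)) * 1 := fun p => by
    have : s + (polarCoord.symm p).1 ^ 2 + (polarCoord.symm p).2 ^ 2 = s + p.1 ^ 2 := by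
      simp only [polarCoord_symm_apply]
      nlinarith [Real.sin_sq_add_cos_sq p.2]
    rw [this, smul_eq_mul, mul_one]
  simp_rw [e]
  rw [setIntegral_prod_mul (fun ρ : ℝ => ρ * gaussProfileDecay c (s + ρ ^ 2)) (fun _ => (1:ℝ))]
  have hder : ∀ ρ ∈ Set.Ici (0:ℝ), HasDerivAt (fun ρ : ℝ => -(1 / 2) * gaussProfile c (s + ρ ^ 2))
      (ρ * gaussProfileDecay c (s + ρ ^ 2)) ρ := fun ρ _ => by
    have h1 : HasDerivAt (fun a : ℝ => s + a ^ 2) (2 * ρ) ρ := by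
      simpa using (hasDerivAt_pow 2 ρ).const_add s
    have h2 := ((hasDerivAt_gaussProfile c (show 0 < s + ρ ^ 2 by positivity)).comp ρ h1).const_mul
      (-(1 / 2) : ℝ)
    exact h2.congr_deriv (by ring)
  have htop : Tendsto (fun ρ : ℝ => -(1 / 2) * gaussProfile c (s + ρ ^ 2)) atTop (nhds 0) := by
    have : Tendsto (fun ρ : ℝ => gaussProfile c (s + ρ ^ 2)) atTop (nhds 0) := by
      have h3 : Tendsto (fun ρ : ℝ => s + ρ ^ 2) atTop atTop :=
        tendsto_atTop_add_const_left _ _ (tendsto_pow_atTop two_ne_zero)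
      refine squeeze_zero (fun ρ => gaussProfile_nonneg c (by positivity))
        (fun ρ => gaussProfile_le hc (by positivity)) ?_
      exact (tendsto_rpow_neg_atTop (by norm_num)).comp h3
    simpa using this.const_mul (-(1 / 2) : ℝ)
  have hi : IntegrableOn (fun ρ : ℝ => ρ * gaussProfileDecay c (s + ρ ^ 2)) (Set.Ioi 0) := by
    refine Integrable.integrableOn ?_
    refine ((integrable_add_sq_rpow (M := s) (α := 1) hs
      (by norm_num)).const_mul C).mono' ?_ (Eventually.of_forall fun b => ?_)
    · exact (measurable_id.mul (measurable_gaussProfileDecay.comp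
        (by fun_prop : Measurable fun b : ℝ => (c, s + b ^ 2)))).aestronglyMeasurable
    · have hp : 0 < s + b ^ 2 := by positivity
      have h1 := h (s + b ^ 2) c hp hc
      have e1 : (s + b ^ 2 + c) ^ (-(5 / 2) : ℝ) ≤ (s + b ^ 2) ^ (-(5 / 2) : ℝ) :=
        Real.rpow_le_rpow_of_nonpos hp (by linarith) (by norm_num)
      have hb : |b| ≤ (s + b ^ 2) ^ (1 / 2 : ℝ) := by
        rw [← Real.sqrt_eq_rpow]
        exact Real.abs_le_sqrt (by linarith)
      rw [norm_mul, Real.norm_eq_abs, Real.norm_eq_abs]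
      calc |b| * |gaussProfileDecay c (s + b ^ 2)|
          ≤ (s + b ^ 2) ^ (1 / 2 : ℝ) * (C * (s + b ^ 2) ^ (-(5 / 2) : ℝ)) := by
            gcongr
            exact h1.trans (by gcongr)
        _ = _ := by
            rw [mul_left_comm, ← Real.rpow_add hp]; norm_num
  rw [integral_Ioi_of_hasDerivAt_of_tendsto' hder hi htop]
  have : volume.real (Set.Ioo (-π) π) = 2 * π := by
    rw [Real.volume_real_Ioo_of_le (by linarith [Real.pi_pos])]; ring
  simp [this]
  ring

theorem integral_two_div_pow_mul_exp {c : ℝ} (hc : 0 < c) :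
    ∫ a in Set.Ioi (0:ℝ), 2 / a ^ 5 * exp (-(c / a ^ 2)) = (c ^ 2)⁻¹ := by
  have h := integral_comp_rpow_Ioi (fun y : ℝ => y * exp (-(c * y)))
    (show (-2 : ℝ) ≠ 0 by norm_num)
  have h2 := Real.integral_rpow_mul_exp_neg_mul_Ioi (a := 2) (r := c) (by norm_num) hc
  norm_num at h2
  rw [h2] at h
  rw [← h]
  refine setIntegral_congr_fun measurableSet_Ioi fun a ha => ?_
  have ha : 0 < a := ha
  have e2 : a ^ (-2 : ℝ) = (a ^ 2)⁻¹ := by rw [Real.rpow_neg ha.le]; norm_cast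
  have e3 : a ^ (-2 - 1 : ℝ) = (a ^ 3)⁻¹ := by
    rw [show (-2 - 1 : ℝ) = -3 by norm_num, Real.rpow_neg ha.le]; norm_cast
  simp only [e2, e3, smul_eq_mul, abs_neg, abs_two, ← div_eq_mul_inv]
  field_simp

theorem integrableOn_two_div_pow_mul_exp {c : ℝ} (hc : 0 < c) :
    IntegrableOn (fun a => 2 / a ^ 5 * exp (-(c / a ^ 2))) (Set.Ioi (0:ℝ)) := by
  refine Integrable.of_integral_ne_zero ?_
  rw [integral_two_div_pow_mul_exp hc]
  positivity

theorem integral_gaussProfile_sq {c : ℝ} (hc : 0 < c) :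
    ∫ a : ℝ, gaussProfile c (a ^ 2) = c⁻¹ := by
  have h2 := integral_comp_abs (f := fun b => gaussProfile c (b ^ 2))
  simp only [sq_abs] at h2
  have h := integral_comp_rpow_Ioi (fun y : ℝ => exp (-c * y)) (show (-2 : ℝ) ≠ 0 by norm_num)
  rw [integral_exp_mul_Ioi (by linarith)] at h
  rw [h2, ← integral_const_mul]
  simp only [mul_zero, exp_zero, neg_div_neg_eq, one_div] at h
  rw [← h]
  refine setIntegral_congr_fun measurableSet_Ioi fun a ha => ?_
  have ha : 0 < a := ha
  have e2 : a ^ (-2 : ℝ) = (a ^ 2)⁻¹ := by rw [Real.rpow_neg ha.le]; norm_cast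
  have e3 : (a ^ 2) ^ (-(3 / 2) : ℝ) = a ^ (-2 - 1 : ℝ) := by
    rw [← Real.rpow_natCast, ← Real.rpow_mul ha.le]; norm_num
  simp only [gaussProfile, e2, e3, smul_eq_mul, abs_neg, abs_two, ← div_eq_mul_inv]
  rw [mul_assoc, neg_div', div_eq_mul_inv]

/-- The time profile of the half-Laplacian of a Gaussian, up to a constant. -/
noncomputable def halfProfile (c r : ℝ) : ℝ := ∫ b : ℝ, gaussProfileDecay c (r + b ^ 2)

theorem measurable_halfProfile : Measurable fun p : ℝ × ℝ => halfProfile p.1 p.2 := by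
  refine StronglyMeasurable.measurable ?_
  refine StronglyMeasurable.integral_prod_right
    (f := fun (p : ℝ × ℝ) (b : ℝ) => gaussProfileDecay p.1 (p.2 + b ^ 2)) ?_
  exact (measurable_gaussProfileDecay.comp
    (by fun_prop : Measurable fun q : (ℝ × ℝ) × ℝ => (q.1.1, q.1.2 + q.2 ^ 2))).stronglyMeasurable

theorem exists_abs_halfProfile_le : ∃ C : ℝ, 0 < C ∧ ∀ r c : ℝ, 0 < r → 0 ≤ c →
    |halfProfile c r| ≤ C * ((r + c) ^ 2)⁻¹ := by
  obtain ⟨C, hC, h⟩ := exists_abs_gaussProfileDecay_le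
  refine ⟨C * π, by positivity, fun r c hr hc => ?_⟩
  have hM : 0 < r + c := by positivity
  rw [halfProfile, ← Real.norm_eq_abs]
  refine (norm_integral_le_of_norm_le
    ((integrable_add_sq_rpow hM (α := 3 / 2) (by norm_num)).const_mul C)
    (Eventually.of_forall fun b => ?_)).trans ?_
  · have := h (r + b ^ 2) c (by positivity) hc
    rw [Real.norm_eq_abs]
    convert this using 3
    · ring
    · norm_num
  · rw [integral_const_mul, mul_assoc]
    gcongr
    refine (integral_add_sq_rpow_le hM (by norm_num)).trans_eq ?_
    rw [← Real.rpow_natCast, ← Real.rpow_neg hM.le]; norm_num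

theorem exists_abs_halfProfile_sub_le : ∃ C : ℝ, 0 < C ∧ ∀ r m c d : ℝ, 0 < r →
    0 ≤ c → 0 ≤ d → 0 < m → m ≤ r + c → m ≤ r + d →
    |halfProfile c r - halfProfile d r| ≤ C * |c - d| * (m ^ 3)⁻¹ := by
  obtain ⟨C, hC, h⟩ := exists_abs_gaussProfileDecay_sub_le
  refine ⟨C * π, by positivity, fun r m c d hr hc hd hm hmc hmd => ?_⟩
  rw [halfProfile, halfProfile, ← integral_sub (integrable_gaussProfileDecay_add_sq hc hr)
    (integrable_gaussProfileDecay_add_sq hd hr), ← Real.norm_eq_abs]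
  refine (norm_integral_le_of_norm_le
    ((integrable_add_sq_rpow hm (α := 5 / 2) (by norm_num)).const_mul (C * |c - d|))
    (Eventually.of_forall fun b => ?_)).trans ?_
  · have := h (r + b ^ 2) (m + b ^ 2) c d (by positivity) hc hd (by positivity)
      (by linarith) (by linarith)
    rw [Real.norm_eq_abs]
    convert this using 3
    norm_num
  · rw [integral_const_mul, mul_assoc, mul_assoc, mul_assoc, mul_left_comm π]
    gcongr
    refine (integral_add_sq_rpow_le hm (by norm_num)).trans_eq ?_
    rw [← Real.rpow_natCast, ← Real.rpow_neg hm.le]; norm_num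

theorem integrable_halfProfile_add_sq {c s : ℝ} (hc : 0 ≤ c) (hs : 0 < s) :
    Integrable fun a : ℝ => halfProfile c (s + a ^ 2) := by
  obtain ⟨C, hC, h⟩ := exists_abs_halfProfile_le
  refine ((integrable_inv_add_sq hs).const_mul (C * s⁻¹)).mono' ?_
    (Eventually.of_forall fun a => ?_)
  · exact (measurable_halfProfile.comp
      (by fun_prop : Measurable fun b : ℝ => (c, s + b ^ 2))).aestronglyMeasurable
  · refine (h _ c (by positivity) hc).trans ?_
    rw [mul_assoc, ← mul_inv]
    gcongr
    nlinarith [mul_nonneg hs.le (sq_nonneg a), sq_nonneg (a ^ 2), mul_nonneg hs.le hc,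
      mul_nonneg hc (sq_nonneg a)]

theorem integral_halfProfile_add_sq {c s : ℝ} (hc : 0 ≤ c) (hs : 0 < s) :
    ∫ a : ℝ, halfProfile c (s + a ^ 2) = π * gaussProfile c s :=
  integral_integral_gaussProfileDecay hc hs

/-- The profile of the Riesz potential of order one of a Gaussian, up to a constant. -/
noncomputable def rieszProfile (c s : ℝ) : ℝ := ∫ a : ℝ, gaussProfile c (s + a ^ 2)

theorem exists_gaussProfile_add_sq_le : ∃ C : ℝ, 0 < C ∧ ∀ s c a : ℝ, 0 ≤ s → 0 ≤ c →
    0 < s + a ^ 2 → |gaussProfile c (s + a ^ 2)| ≤ C * (s + c + a ^ 2) ^ (-(1 / 2 + 1) : ℝ) := by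
  obtain ⟨C, hC, h⟩ := exists_gaussProfile_le
  refine ⟨C, hC, fun s c a hs hc h0 => ?_⟩
  rw [abs_of_nonneg (gaussProfile_nonneg c h0.le)]
  convert h _ c h0 hc using 3
  · ring
  · norm_num

theorem exists_abs_rieszProfile_le : ∃ C : ℝ, 0 < C ∧ ∀ s c : ℝ, 0 < s → 0 ≤ c →
    |rieszProfile c s| ≤ C * (s + c)⁻¹ := by
  obtain ⟨C, hC, h⟩ := exists_gaussProfile_add_sq_le
  refine ⟨C * π, by positivity, fun s c hs hc => ?_⟩
  have hM : 0 < s + c := by positivity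
  rw [rieszProfile, ← Real.norm_eq_abs]
  refine (norm_integral_le_of_norm_le
    ((integrable_add_sq_rpow hM (α := 1 / 2) (by norm_num)).const_mul C)
    (Eventually.of_forall fun b => h s c b hs.le hc (by positivity))).trans ?_
  rw [integral_const_mul, mul_assoc]
  gcongr
  refine (integral_add_sq_rpow_le hM (by norm_num)).trans_eq ?_
  rw [← Real.rpow_neg_one]; norm_num

theorem measurable_rieszProfile : Measurable fun p : ℝ × ℝ => rieszProfile p.1 p.2 := by
  refine StronglyMeasurable.measurable ?_
  refine StronglyMeasurable.integral_prod_right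
    (f := fun (p : ℝ × ℝ) (b : ℝ) => gaussProfile p.1 (p.2 + b ^ 2)) ?_
  exact (measurable_gaussProfile.comp
    (by fun_prop : Measurable fun q : (ℝ × ℝ) × ℝ => (q.1.1, q.1.2 + q.2 ^ 2))).stronglyMeasurable

theorem tendsto_rieszProfile {c : ℝ} (hc : 0 < c) :
    Tendsto (rieszProfile c) (nhdsWithin 0 (Set.Ioi 0)) (nhds c⁻¹) := by
  obtain ⟨C, hC, h⟩ := exists_gaussProfile_add_sq_le
  rw [← integral_gaussProfile_sq hc]
  refine tendsto_integral_filter_of_dominated_convergence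
    (fun a => C * (c + a ^ 2) ^ (-(1 / 2 + 1) : ℝ)) ?_ ?_
    ((integrable_add_sq_rpow hc (by norm_num)).const_mul C) ?_
  · exact Eventually.of_forall fun s => (measurable_gaussProfile.comp
      (by fun_prop : Measurable fun b : ℝ => (c, s + b ^ 2))).aestronglyMeasurable
  · filter_upwards [self_mem_nhdsWithin] with s hs
    have hs : 0 < s := hs
    refine Eventually.of_forall fun a => (h s c a hs.le hc.le (by positivity)).trans ?_
    gcongr ?_ * ?_
    exact Real.rpow_le_rpow_of_nonpos (by positivity) (by linarith) (by norm_num)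
  · filter_upwards [compl_mem_ae_iff.2 (measure_singleton (0:ℝ))] with a ha
    have ha : a ≠ 0 := ha
    have h1 : ContinuousAt (gaussProfile c) (0 + a ^ 2) :=
      (hasDerivAt_gaussProfile c (by positivity)).continuousAt
    have h2 : ContinuousAt (fun s : ℝ => gaussProfile c (s + a ^ 2)) 0 :=
      ContinuousAt.comp (f := fun s : ℝ => s + a ^ 2) h1 (by fun_prop)
    simpa using h2.tendsto.mono_left nhdsWithin_le_nhds

theorem exists_pow_mul_exp_neg_sq_le {r : ℝ} (hr : 0 < r) (N : ℕ) :
    ∃ C : ℝ, ∀ t : ℝ, 0 ≤ t → (1 + t) ^ N * exp (-(t ^ 2 / r)) ≤ C := by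
  refine ⟨N.factorial * exp (1 + r / 4), fun t ht => ?_⟩
  have h1 : (1 + t) ^ N ≤ N.factorial * exp (1 + t) := by
    have := Real.pow_div_factorial_le_exp (1 + t) (by positivity) N
    rwa [div_le_iff₀' (by positivity)] at this
  have h2 : t ≤ t ^ 2 / r + r / 4 := by
    have : 0 ≤ (t - r / 2) ^ 2 / r := by positivity
    have e : (t - r / 2) ^ 2 / r = t ^ 2 / r - t + r / 4 := by field_simp; ring
    linarith
  calc (1 + t) ^ N * exp (-(t ^ 2 / r)) ≤ N.factorial * exp (1 + t) * exp (-(t ^ 2 / r)) := by gcongr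
    _ = N.factorial * exp (1 + t - t ^ 2 / r) := by rw [mul_assoc, ← exp_add]; ring_nf
    _ ≤ _ := by gcongr; linarith

/-- The Gaussian `x ↦ exp (-‖x‖² / r)` as a Schwartz function. -/
noncomputable def expNegSqSchwartz (r : ℝ) (hr : 0 < r) : SchwartzMap E3 ℝ where
  toFun x := exp (-(‖x‖ ^ 2 / r))
  smooth' := by
    exact (((contDiff_norm_sq ℝ).div_const r).neg).exp
  decay' k n := by
    have hf : Function.HasTemperateGrowth fun x : E3 => -(‖x‖ ^ 2 / r) := by
      have h1 : Function.HasTemperateGrowth fun x : E3 => ‖x‖ ^ 2 * (-r⁻¹) :=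
        (Function.hasTemperateGrowth_norm_sq E3).mul (Function.HasTemperateGrowth.const _)
      convert h1 using 2
      ring
    obtain ⟨l, C, hC, h⟩ := hf.norm_iteratedFDeriv_le_uniform n
    obtain ⟨K, hK⟩ := exists_pow_mul_exp_neg_sq_le hr (k + l * n)
    refine ⟨n.factorial * (C + 1) ^ n * K, fun x => ?_⟩
    have h1 : ‖iteratedFDeriv ℝ n (exp ∘ fun x : E3 => -(‖x‖ ^ 2 / r)) x‖ ≤
        n.factorial * exp (-(‖x‖ ^ 2 / r)) * ((C + 1) * (1 + ‖x‖) ^ l) ^ n := by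
      refine norm_iteratedFDeriv_comp_le (N := (⊤ : ℕ∞)) Real.contDiff_exp hf.1
        (by exact_mod_cast le_top) x ?_ ?_
      · intro i _
        rw [norm_iteratedFDeriv_eq_norm_iteratedDeriv, iteratedDeriv_eq_iterate, Real.iter_deriv_exp,
          Real.norm_of_nonneg (exp_pos _).le]
      · intro i hi hin
        have hD : 1 ≤ (C + 1) * (1 + ‖x‖) ^ l :=
          one_le_mul_of_one_le_of_one_le (by linarith)
            (one_le_pow₀ (by linarith [norm_nonneg x]))
        calc _ ≤ C * (1 + ‖x‖) ^ l := h i hin x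
          _ ≤ (C + 1) * (1 + ‖x‖) ^ l := by gcongr; linarith
          _ ≤ _ := le_self_pow₀ hD (by omega)
    have h2 : ‖x‖ ^ k ≤ (1 + ‖x‖) ^ k := by gcongr; linarith
    change ‖x‖ ^ k * ‖iteratedFDeriv ℝ n (exp ∘ fun x : E3 => -(‖x‖ ^ 2 / r)) x‖ ≤ _
    calc _ ≤ (1 + ‖x‖) ^ k *
        (n.factorial * exp (-(‖x‖ ^ 2 / r)) * ((C + 1) * (1 + ‖x‖) ^ l) ^ n) := by gcongr
      _ = n.factorial * (C + 1) ^ n * ((1 + ‖x‖) ^ (k + l * n) * exp (-(‖x‖ ^ 2 / r))) := by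
        rw [mul_pow, ← pow_mul, pow_add]; ring
      _ ≤ _ := by gcongr; exact hK _ (norm_nonneg x)

/-- The Gaussian `x ↦ gaussProfile ‖x₀ - x‖² r` as a Schwartz function. -/
noncomputable def gaussSchwartz (r : ℝ) (hr : 0 < r) (x₀ : E3) : SchwartzMap E3 ℝ :=
  r ^ (-(3 / 2) : ℝ) • (expNegSqSchwartz r hr).compSubConstCLM ℝ x₀

theorem gaussSchwartz_apply (r : ℝ) (hr : 0 < r) (x₀ x : E3) :
    gaussSchwartz r hr x₀ x = gaussProfile (‖x₀ - x‖ ^ 2) r := by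
  rw [gaussSchwartz, smul_apply, SchwartzMap.compSubConstCLM_apply, gaussProfile,
    norm_sub_rev x₀ x]
  rfl

theorem integrable_exp_neg_mul_norm_sq {b : ℝ} (hb : 0 < b) :
    Integrable fun z : E3 => exp (-b * ‖z‖ ^ 2) := by
  refine Integrable.of_integral_ne_zero ?_
  rw [GaussianFourier.integral_rexp_neg_mul_sq_norm hb]
  positivity

theorem exp_mul_gaussProfile_eq {r q : ℝ} (hr : 0 < r) (hq : 0 < q) (v z : E3) :
    exp (-(‖z‖ ^ 2 / q)) * gaussProfile (‖v + z‖ ^ 2) r =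
      r ^ (-(3 / 2) : ℝ) * exp (-(‖v‖ ^ 2 / (r + q))) *
        exp (-((r + q) / (r * q)) * ‖z + (q / (r + q)) • v‖ ^ 2) := by
  rw [gaussProfile, mul_left_comm, ← exp_add, mul_assoc, ← exp_add]
  congr 2
  rw [norm_add_sq_real, norm_add_sq_real, norm_smul, real_inner_smul_right, real_inner_comm,
    Real.norm_of_nonneg (by positivity)]
  field_simp
  ring

theorem integrable_exp_mul_gaussProfile {r q : ℝ} (hr : 0 < r) (hq : 0 < q) (v : E3) :
    Integrable fun z : E3 => exp (-(‖z‖ ^ 2 / q)) * gaussProfile (‖v + z‖ ^ 2) r := by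
  simp_rw [exp_mul_gaussProfile_eq hr hq v]
  exact ((integrable_exp_neg_mul_norm_sq (by positivity)).comp_add_right _).const_mul _

theorem integral_exp_mul_gaussProfile {r q : ℝ} (hr : 0 < r) (hq : 0 < q) (v : E3) :
    ∫ z : E3, exp (-(‖z‖ ^ 2 / q)) * gaussProfile (‖v + z‖ ^ 2) r =
      (π * q) ^ (3 / 2 : ℝ) * gaussProfile (‖v‖ ^ 2) (r + q) := by
  simp_rw [exp_mul_gaussProfile_eq hr hq v]
  rw [integral_const_mul, integral_add_right_eq_self (μ := (volume : Measure E3))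
    (fun z : E3 => exp (-((r + q) / (r * q)) * ‖z‖ ^ 2)),
    GaussianFourier.integral_rexp_neg_mul_sq_norm (by positivity), gaussProfile,
    finrank_euclideanSpace_fin, Nat.cast_ofNat]
  have e : π / ((r + q) / (r * q)) = (π * q) * r / (r + q) := by field_simp
  rw [e, Real.div_rpow (by positivity) (by positivity), Real.mul_rpow (by positivity) hr.le,
    Real.rpow_neg hr.le, Real.rpow_neg (by positivity)]
  field_simp

theorem integral_exp_neg_norm_sq_div {q : ℝ} (hq : 0 < q) :
    ∫ z : E3, exp (-(‖z‖ ^ 2 / q)) = (π * q) ^ (3 / 2 : ℝ) := by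
  have := GaussianFourier.integral_rexp_neg_mul_sq_norm (V := E3) (b := q⁻¹) (by positivity)
  rw [finrank_euclideanSpace_fin, Nat.cast_ofNat, div_inv_eq_mul] at this
  rw [← this]
  congr 1 with z
  ring_nf

theorem integrable_exp_neg_norm_sq_div {q : ℝ} (hq : 0 < q) :
    Integrable fun z : E3 => exp (-(‖z‖ ^ 2 / q)) := by
  convert integrable_exp_neg_mul_norm_sq (b := q⁻¹) (by positivity) using 3
  ring

/-- Half of the negated second difference of a Gaussian. -/
noncomputable def gaussSecondDiff (r : ℝ) (v z : E3) : ℝ :=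
  gaussProfile (‖v‖ ^ 2) r - (gaussProfile (‖v + z‖ ^ 2) r + gaussProfile (‖v - z‖ ^ 2) r) / 2

theorem integral_exp_mul_gaussSecondDiff {r q : ℝ} (hr : 0 < r) (hq : 0 < q) (v : E3) :
    ∫ z : E3, exp (-(‖z‖ ^ 2 / q)) * gaussSecondDiff r v z =
      (π * q) ^ (3 / 2 : ℝ) * (gaussProfile (‖v‖ ^ 2) r - gaussProfile (‖v‖ ^ 2) (r + q)) := by
  have hneg : ∀ z : E3, ‖-v + z‖ = ‖v - z‖ := fun z => by rw [← norm_neg]; congr 1; abel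
  have i1 := integrable_exp_mul_gaussProfile hr hq v
  have i2 := integrable_exp_mul_gaussProfile hr hq (-v)
  have e1 := integral_exp_mul_gaussProfile hr hq v
  have e2 := integral_exp_mul_gaussProfile hr hq (-v)
  simp only [hneg, norm_neg] at i2 e2
  have e : ∀ z : E3, exp (-(‖z‖ ^ 2 / q)) * gaussSecondDiff r v z =
      exp (-(‖z‖ ^ 2 / q)) * gaussProfile (‖v‖ ^ 2) r -
      (exp (-(‖z‖ ^ 2 / q)) * gaussProfile (‖v + z‖ ^ 2) r
        + exp (-(‖z‖ ^ 2 / q)) * gaussProfile (‖v - z‖ ^ 2) r) / 2 := fun z => by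
    rw [gaussSecondDiff]; ring
  simp_rw [e]
  rw [integral_sub ((integrable_exp_neg_norm_sq_div hq).mul_const _)
    (by exact (i1.add i2).div_const 2), integral_mul_const, integral_div,
    integral_add i1 i2, e1, e2, integral_exp_neg_norm_sq_div hq]
  ring

theorem gaussSecondDiff_eq (r : ℝ) (v z : E3) :
    gaussSecondDiff r v z = gaussProfile (‖v‖ ^ 2) r *
      (1 - exp (-(‖z‖ ^ 2 / r)) * cosh (2 * inner ℝ v z / r)) := by
  rw [gaussSecondDiff, gaussProfile, gaussProfile, gaussProfile, norm_add_sq_real, norm_sub_sq_real,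
    Real.cosh_eq]
  have e1 : exp (-((‖v‖ ^ 2 + 2 * inner ℝ v z + ‖z‖ ^ 2) / r)) =
      exp (-(‖v‖ ^ 2 / r)) * exp (-(‖z‖ ^ 2 / r)) * exp (-(2 * inner ℝ v z / r)) := by
    rw [← exp_add, ← exp_add]; ring_nf
  have e2 : exp (-((‖v‖ ^ 2 - 2 * inner ℝ v z + ‖z‖ ^ 2) / r)) =
      exp (-(‖v‖ ^ 2 / r)) * exp (-(‖z‖ ^ 2 / r)) * exp (2 * inner ℝ v z / r) := by
    rw [← exp_add, ← exp_add]; ring_nf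
  rw [e1, e2]
  ring

theorem exists_abs_gaussSecondDiff_le {r : ℝ} (hr : 0 < r) (v : E3) : ∃ K : ℝ, 0 < K ∧
    ∀ z : E3, |gaussSecondDiff r v z| ≤ K * (‖z‖ ^ 2 * (1 + ‖z‖ ^ 2)⁻¹) := by
  set B := r ^ (-(3 / 2) : ℝ) with hB
  have hB0 : 0 < B := by positivity
  set κ := 2 * ‖v‖ ^ 2 / r ^ 2 with hκ
  have hκ0 : 0 ≤ κ := by positivity
  set A := κ * exp κ + 1 / r with hA
  have hA0 : 0 < A := by positivity
  have hg0 := gaussProfile_nonneg (‖v‖ ^ 2) hr.le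
  have hgB : gaussProfile (‖v‖ ^ 2) r ≤ B := gaussProfile_le (by positivity) hr
  have small : ∀ z : E3, ‖z‖ ^ 2 ≤ 1 → |gaussSecondDiff r v z| ≤ B * A * ‖z‖ ^ 2 := by
    intro z hz
    rw [gaussSecondDiff_eq r, abs_mul, abs_of_nonneg hg0, mul_assoc]
    set t := 2 * inner ℝ v z / r with ht
    have hE1 : exp (-(‖z‖ ^ 2 / r)) ≤ 1 := Real.exp_le_one_iff.2 (by
      have : 0 ≤ ‖z‖ ^ 2 / r := by positivity
      linarith)
    have hE2 : 1 - ‖z‖ ^ 2 / r ≤ exp (-(‖z‖ ^ 2 / r)) := by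
      linarith [add_one_le_exp (-(‖z‖ ^ 2 / r))]
    have hc1 : 1 ≤ cosh t := one_le_cosh t
    have ht2 : t ^ 2 / 2 ≤ κ * ‖z‖ ^ 2 := by
      have h1 : (inner ℝ v z) ^ 2 ≤ (‖v‖ * ‖z‖) ^ 2 := by
        rw [← sq_abs]; gcongr; exact abs_real_inner_le_norm v z
      calc t ^ 2 / 2 = 2 / r ^ 2 * (inner ℝ v z) ^ 2 := by rw [ht]; field_simp
        _ ≤ 2 / r ^ 2 * (‖v‖ * ‖z‖) ^ 2 := by gcongr
        _ = _ := by rw [hκ]; ring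
    have hc2 : cosh t - 1 ≤ κ * ‖z‖ ^ 2 * exp κ := by
      have h1 := (cosh_le_exp_half_sq t).trans (exp_le_exp.2 ht2)
      set y := κ * ‖z‖ ^ 2
      have hy : 0 ≤ y := by positivity
      have hyk : y ≤ κ := by nlinarith
      have h2 : exp y - 1 ≤ y * exp y := by
        have := add_one_le_exp (-y)
        have h3 : exp y * exp (-y) = 1 := by rw [← exp_add]; simp
        nlinarith [exp_pos y]
      have h4 : y * exp y ≤ y * exp κ := by gcongr
      linarith
    have hz0 : 0 ≤ ‖z‖ ^ 2 := by positivity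
    gcongr
    rw [hA, abs_le]
    have p1 : 0 ≤ exp (-(‖z‖ ^ 2 / r)) := (exp_pos _).le
    have e3 : (κ * exp κ + 1 / r) * ‖z‖ ^ 2 = κ * ‖z‖ ^ 2 * exp κ + ‖z‖ ^ 2 / r := by ring
    have p2 : 0 ≤ ‖z‖ ^ 2 / r := by positivity
    have p3 : 0 ≤ κ * ‖z‖ ^ 2 * exp κ := by positivity
    rw [e3]
    constructor
    · nlinarith
    · nlinarith
  have large : ∀ z : E3, |gaussSecondDiff r v z| ≤ B := by
    intro z
    have h1 := gaussProfile_nonneg (‖v + z‖ ^ 2) hr.le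
    have h2 := gaussProfile_nonneg (‖v - z‖ ^ 2) hr.le
    have h3 : gaussProfile (‖v + z‖ ^ 2) r ≤ B := gaussProfile_le (by positivity) hr
    have h4 : gaussProfile (‖v - z‖ ^ 2) r ≤ B := gaussProfile_le (by positivity) hr
    rw [gaussSecondDiff, abs_le]
    constructor <;> linarith
  refine ⟨2 * (B * A) + 2 * B, by positivity, fun z => ?_⟩
  rw [← div_eq_mul_inv, ← mul_div_assoc, le_div_iff₀ (by positivity)]
  have hz0 : 0 ≤ ‖z‖ ^ 2 := by positivity
  have hBA : 0 < B * A := by positivity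
  rcases le_total (‖z‖ ^ 2) 1 with hz | hz
  · calc _ ≤ B * A * ‖z‖ ^ 2 * (1 + 1) := by
          refine mul_le_mul (small z hz) (by linarith) (by positivity) (by positivity)
      _ ≤ _ := by nlinarith
  · calc _ ≤ B * (1 + ‖z‖ ^ 2) := by gcongr; exact large z
      _ ≤ _ := by nlinarith

theorem integrable_norm_sq_inv_mul : Integrable fun z : E3 => (‖z‖ ^ 2)⁻¹ * (1 + ‖z‖ ^ 2)⁻¹ := by
  rw [integrable_fun_norm_addHaar volume (f := fun y : ℝ => (y ^ 2)⁻¹ * (1 + y ^ 2)⁻¹)]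
  refine (integrable_inv_one_add_sq.integrableOn).congr_fun (fun y hy => ?_) measurableSet_Ioi
  have hy : 0 < y := hy
  simp only [finrank_euclideanSpace_fin, smul_eq_mul]
  field_simp

theorem measurable_gaussSecondDiff (r : ℝ) (v : E3) : Measurable (gaussSecondDiff r v) := by
  unfold gaussSecondDiff
  have h : ∀ f : E3 → ℝ, Measurable f → Measurable fun z => gaussProfile (f z) r := fun f hf =>
    measurable_gaussProfile.comp (hf.prodMk measurable_const)
  exact measurable_const.sub (((h _ (by fun_prop)).add (h _ (by fun_prop))).div_const _)

theorem integrable_gaussSecondDiff_div {r : ℝ} (hr : 0 < r) (v : E3) :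
    Integrable fun z : E3 => gaussSecondDiff r v z / ‖z‖ ^ 4 := by
  obtain ⟨K, hK, h⟩ := exists_abs_gaussSecondDiff_le hr v
  refine (integrable_norm_sq_inv_mul.const_mul K).mono' ?_ (Eventually.of_forall fun z => ?_)
  · exact ((measurable_gaussSecondDiff r v).div (by fun_prop)).aestronglyMeasurable
  · rcases eq_or_ne z 0 with rfl | hz
    · simp
    · have hz : 0 < ‖z‖ := norm_pos_iff.2 hz
      rw [Real.norm_eq_abs, abs_div, abs_of_nonneg (by positivity : 0 ≤ ‖z‖ ^ 4),
        div_le_iff₀ (by positivity)]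
      refine (h z).trans_eq ?_
      field_simp

theorem integral_gaussSecondDiff_div {r : ℝ} (hr : 0 < r) (v : E3) :
    ∫ z : E3, gaussSecondDiff r v z / ‖z‖ ^ 4 =
      2 * π ^ (3 / 2 : ℝ) * halfProfile (‖v‖ ^ 2) r := by
  have hz : ∀ᵐ z : E3, z ≠ 0 := compl_mem_ae_iff.2 (measure_singleton 0)
  have hI := integrable_gaussSecondDiff_div hr v
  have h1 : ∀ᵐ z : E3, gaussSecondDiff r v z / ‖z‖ ^ 4 =
      ∫ a in Set.Ioi (0:ℝ), gaussSecondDiff r v z * (2 / a ^ 5 * exp (-(‖z‖ ^ 2 / a ^ 2))) := by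
    filter_upwards [hz] with z hz
    rw [integral_const_mul, integral_two_div_pow_mul_exp (by positivity), div_eq_mul_inv, ← pow_mul]
  rw [integral_congr_ae h1, integral_integral_swap]
  · rw [halfProfile, ← integral_gaussProfile_sub_div_sq (by positivity) hr, ← integral_const_mul]
    refine setIntegral_congr_fun measurableSet_Ioi fun a ha => ?_
    have ha : 0 < a := ha
    have e : ∀ z : E3, gaussSecondDiff r v z * (2 / a ^ 5 * exp (-(‖z‖ ^ 2 / a ^ 2))) =
        2 / a ^ 5 * (exp (-(‖z‖ ^ 2 / a ^ 2)) * gaussSecondDiff r v z) := fun z => by ring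
    simp_rw [e]
    rw [integral_const_mul, integral_exp_mul_gaussSecondDiff hr (by positivity),
      Real.mul_rpow Real.pi_pos.le (by positivity)]
    have e3 : (a ^ 2) ^ (3 / 2 : ℝ) = a ^ 3 := by
      rw [← Real.rpow_natCast, ← Real.rpow_natCast, ← Real.rpow_mul ha.le]; norm_num
    rw [e3]
    field_simp
  · have hm : Measurable fun p : E3 × ℝ =>
        gaussSecondDiff r v p.1 * (2 / p.2 ^ 5 * exp (-(‖p.1‖ ^ 2 / p.2 ^ 2))) :=
      ((measurable_gaussSecondDiff r v).comp measurable_fst).mul (by fun_prop)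
    refine (integrable_prod_iff hm.aestronglyMeasurable).2 ⟨?_, ?_⟩
    · filter_upwards [hz] with z hz
      exact (integrableOn_two_div_pow_mul_exp (by positivity)).const_mul _
    · refine hI.norm.congr ?_
      filter_upwards [hz] with z hz
      have : ∀ a ∈ Set.Ioi (0:ℝ),
          ‖gaussSecondDiff r v z * (2 / a ^ 5 * exp (-(‖z‖ ^ 2 / a ^ 2)))‖ =
          ‖gaussSecondDiff r v z‖ * (2 / a ^ 5 * exp (-(‖z‖ ^ 2 / a ^ 2))) := fun a ha => by
        have ha : 0 < a := ha
        rw [norm_mul, Real.norm_of_nonneg (by positivity : 0 ≤ 2 / a ^ 5 * exp (-(‖z‖ ^ 2 / a ^ 2)))]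
      rw [setIntegral_congr_fun measurableSet_Ioi this, integral_const_mul,
        integral_two_div_pow_mul_exp (by positivity), norm_div, div_eq_mul_inv,
        Real.norm_of_nonneg (by positivity : 0 ≤ ‖z‖ ^ 4), ← pow_mul]

theorem integrableOn_gaussDiff_div {r ε : ℝ} (hr : 0 < r) (hε : 0 < ε) (v : E3) :
    IntegrableOn (fun z : E3 =>
      (gaussProfile (‖v‖ ^ 2) r - gaussProfile (‖v + z‖ ^ 2) r) / ‖z‖ ^ 4) {z | ε < ‖z‖} := by
  have hS : MeasurableSet {z : E3 | ε < ‖z‖} := measurableSet_lt measurable_const measurable_norm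
  refine ((integrable_norm_sq_inv_mul.const_mul
    (r ^ (-(3 / 2) : ℝ) * (1 + (ε ^ 2)⁻¹))).integrableOn).mono' ?_ ?_
  · have h : Measurable fun z : E3 => gaussProfile (‖v + z‖ ^ 2) r :=
      measurable_gaussProfile.comp (Measurable.prodMk (by fun_prop) measurable_const)
    exact ((measurable_const.sub h).div (by fun_prop)).aestronglyMeasurable
  · refine (ae_restrict_iff' hS).2 (Eventually.of_forall fun z hz => ?_)
    have hz : ε < ‖z‖ := hz
    have hz0 : 0 < ‖z‖ := hε.trans hz
    have h1 := gaussProfile_nonneg (‖v‖ ^ 2) hr.le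
    have h2 := gaussProfile_nonneg (‖v + z‖ ^ 2) hr.le
    have h3 : gaussProfile (‖v‖ ^ 2) r ≤ r ^ (-(3 / 2) : ℝ) := gaussProfile_le (by positivity) hr
    have h4 : gaussProfile (‖v + z‖ ^ 2) r ≤ r ^ (-(3 / 2) : ℝ) :=
      gaussProfile_le (by positivity) hr
    have h5 : |gaussProfile (‖v‖ ^ 2) r - gaussProfile (‖v + z‖ ^ 2) r| ≤ r ^ (-(3 / 2) : ℝ) := by
      rw [abs_le]; constructor <;> linarith
    have h6 : ε ^ 2 ≤ ‖z‖ ^ 2 := by gcongr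
    have h7 : (‖z‖ ^ 4)⁻¹ ≤ (1 + (ε ^ 2)⁻¹) * ((‖z‖ ^ 2)⁻¹ * (1 + ‖z‖ ^ 2)⁻¹) := by
      rw [← mul_inv, ← div_eq_mul_inv, inv_eq_one_div, div_le_div_iff₀ (by positivity)
        (by positivity)]
      have h8 : 1 ≤ (ε ^ 2)⁻¹ * ‖z‖ ^ 2 := by
        rw [inv_mul_eq_div, le_div_iff₀ (by positivity)]; linarith
      calc 1 * (‖z‖ ^ 2 * (1 + ‖z‖ ^ 2)) ≤ ‖z‖ ^ 2 * ((ε ^ 2)⁻¹ * ‖z‖ ^ 2 + ‖z‖ ^ 2) := by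
            rw [one_mul]; gcongr
        _ = _ := by ring
    rw [Real.norm_eq_abs, abs_div, abs_of_nonneg (by positivity : 0 ≤ ‖z‖ ^ 4), div_eq_mul_inv,
      mul_assoc]
    gcongr

theorem setIntegral_gaussDiff_div {r ε : ℝ} (hr : 0 < r) (hε : 0 < ε) (v : E3) :
    ∫ z in {z : E3 | ε < ‖z‖},
      (gaussProfile (‖v‖ ^ 2) r - gaussProfile (‖v + z‖ ^ 2) r) / ‖z‖ ^ 4 =
    ∫ z in {z : E3 | ε < ‖z‖}, gaussSecondDiff r v z / ‖z‖ ^ 4 := by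
  set S := {z : E3 | ε < ‖z‖} with hSdef
  have hS : MeasurableSet S := measurableSet_lt measurable_const measurable_norm
  set g := fun z : E3 => (gaussProfile (‖v‖ ^ 2) r - gaussProfile (‖v + z‖ ^ 2) r) / ‖z‖ ^ 4
  have hi : Integrable (S.indicator g) :=
    (integrable_indicator_iff hS).2 (integrableOn_gaussDiff_div hr hε v)
  have hneg := integral_neg_eq_self (S.indicator g) volume
  have hadd := integral_add hi hi.comp_neg
  rw [← integral_indicator hS, ← integral_indicator hS]
  have e : ∀ z, S.indicator (fun z => gaussSecondDiff r v z / ‖z‖ ^ 4) z =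
      (S.indicator g z + S.indicator g (-z)) / 2 := by
    intro z
    by_cases hz : z ∈ S
    · have hz' : -z ∈ S := by simpa [hSdef] using hz
      rw [Set.indicator_of_mem hz, Set.indicator_of_mem hz, Set.indicator_of_mem hz']
      simp only [g, gaussSecondDiff, norm_neg, ← sub_eq_add_neg]
      ring
    · have hz' : -z ∉ S := by simpa [hSdef] using hz
      rw [Set.indicator_of_notMem hz, Set.indicator_of_notMem hz, Set.indicator_of_notMem hz']
      simp
  simp_rw [e]
  rw [integral_div, hadd, hneg]
  ring

theorem tendsto_setIntegral_norm_gt {G : E3 → ℝ} (hG : Integrable G) :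
    Tendsto (fun ε : ℝ => ∫ z in {z : E3 | ε < ‖z‖}, G z) (nhdsWithin 0 (Set.Ioi 0))
      (nhds (∫ z, G z)) := by
  have hS : ∀ ε : ℝ, MeasurableSet {z : E3 | ε < ‖z‖} := fun ε =>
    measurableSet_lt measurable_const measurable_norm
  simp_rw [← fun ε => integral_indicator (f := G) (μ := volume) (hS ε)]
  refine tendsto_integral_filter_of_dominated_convergence (fun z => ‖G z‖)
    (Eventually.of_forall fun ε => hG.1.indicator (hS ε))
    (Eventually.of_forall fun ε => Eventually.of_forall fun z => norm_indicator_le_norm_self _ _)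
    hG.norm ?_
  have hz : ∀ᵐ z : E3, z ≠ 0 := compl_mem_ae_iff.2 (measure_singleton 0)
  filter_upwards [hz] with z hz
  refine tendsto_const_nhds.congr' ?_
  have : ∀ᶠ ε : ℝ in nhdsWithin 0 (Set.Ioi 0), ε < ‖z‖ :=
    mem_nhdsWithin_of_mem_nhds (Iio_mem_nhds (norm_pos_iff.2 hz))
  filter_upwards [this] with ε hε
  exact (Set.indicator_of_mem (s := {z : E3 | ε < ‖z‖}) hε G).symm

theorem halfLap_gaussSchwartz {r : ℝ} (hr : 0 < r) (x₀ x : E3) :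
    halfLap (gaussSchwartz r hr x₀) x =
      (1 / π ^ 2) * (2 * π ^ (3 / 2 : ℝ) * halfProfile (‖x₀ - x‖ ^ 2) r) := by
  refine Tendsto.limUnder_eq (Tendsto.const_mul _ ?_)
  rw [← integral_gaussSecondDiff_div hr]
  refine (tendsto_setIntegral_norm_gt (integrable_gaussSecondDiff_div hr (x₀ - x))).congr' ?_
  filter_upwards [self_mem_nhdsWithin] with ε hε
  have hε : 0 < ε := hε
  rw [← setIntegral_gaussDiff_div hr hε]
  have hS : MeasurableSet {z : E3 | ε < ‖z‖} := measurableSet_lt measurable_const measurable_norm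
  have hS' : MeasurableSet {y : E3 | ε < ‖x - y‖} :=
    measurableSet_lt measurable_const (by fun_prop)
  rw [← integral_indicator hS, ← integral_indicator hS', ← integral_sub_left_eq_self _ volume x]
  congr 1 with y
  simp only [Set.indicator, Set.mem_ofPred_eq, gaussSchwartz_apply, sub_add_sub_cancel]

theorem exists_one_add_norm_sq_le {s : ℝ} (hs : 0 < s) (x₀ : E3) :
    ∃ M : ℝ, 1 ≤ M ∧ ∀ x : E3, 1 + ‖x‖ ^ 2 ≤ M * (s + ‖x₀ - x‖ ^ 2) := by
  refine ⟨2 + (1 + 2 * ‖x₀‖ ^ 2) / s, ?_, fun x => ?_⟩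
  · have : 0 ≤ (1 + 2 * ‖x₀‖ ^ 2) / s := by positivity
    linarith
  · have h1 : ‖x‖ ≤ ‖x₀‖ + ‖x₀ - x‖ := by
      calc ‖x‖ = ‖x₀ - (x₀ - x)‖ := by rw [sub_sub_cancel]
        _ ≤ _ := norm_sub_le _ _
    have h2 : ‖x‖ ^ 2 ≤ 2 * ‖x₀‖ ^ 2 + 2 * ‖x₀ - x‖ ^ 2 := by
      calc ‖x‖ ^ 2 ≤ (‖x₀‖ + ‖x₀ - x‖) ^ 2 := by gcongr
        _ ≤ _ := by nlinarith [sq_nonneg (‖x₀‖ - ‖x₀ - x‖)]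
    have h3 : (2 + (1 + 2 * ‖x₀‖ ^ 2) / s) * (s + ‖x₀ - x‖ ^ 2) = 2 * s + 2 * ‖x₀ - x‖ ^ 2 +
        (1 + 2 * ‖x₀‖ ^ 2) + (1 + 2 * ‖x₀‖ ^ 2) / s * ‖x₀ - x‖ ^ 2 := by field_simp; ring
    have h4 : 0 ≤ (1 + 2 * ‖x₀‖ ^ 2) / s * ‖x₀ - x‖ ^ 2 := by positivity
    linarith

theorem exists_abs_norm_sq_sub_le (x₀ x₁ : E3) : ∃ D : ℝ, 0 < D ∧
    ∀ x : E3, |‖x₀ - x‖ ^ 2 - ‖x₁ - x‖ ^ 2| ≤ D * (1 + ‖x‖ ^ 2) ^ (1 / 2 : ℝ) := by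
  refine ⟨‖x₀‖ ^ 2 + ‖x₁‖ ^ 2 + 2 * ‖x₀ - x₁‖ + 1, by positivity, fun x => ?_⟩
  have h1 : ‖x₀ - x‖ ^ 2 - ‖x₁ - x‖ ^ 2 = ‖x₀‖ ^ 2 - ‖x₁‖ ^ 2 - 2 * inner ℝ (x₀ - x₁) x := by
    rw [norm_sub_sq_real, norm_sub_sq_real, inner_sub_left]; ring
  have h2 := abs_real_inner_le_norm (x₀ - x₁) x
  rw [← Real.sqrt_eq_rpow]
  have h3 : 1 ≤ √(1 + ‖x‖ ^ 2) := Real.one_le_sqrt.2 (by nlinarith [norm_nonneg x])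
  have h4 : ‖x‖ ≤ √(1 + ‖x‖ ^ 2) := Real.le_sqrt_of_sq_le (by linarith)
  have h5 : |‖x₀ - x‖ ^ 2 - ‖x₁ - x‖ ^ 2| ≤
      ‖x₀‖ ^ 2 + ‖x₁‖ ^ 2 + 2 * (‖x₀ - x₁‖ * ‖x‖) := by
    rw [h1]
    rw [abs_le] at h2 ⊢
    constructor <;> nlinarith [sq_nonneg ‖x₀‖, sq_nonneg ‖x₁‖]
  refine h5.trans ?_
  have h6 : ‖x₀ - x₁‖ * ‖x‖ ≤ ‖x₀ - x₁‖ * √(1 + ‖x‖ ^ 2) := by gcongr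
  nlinarith [sq_nonneg ‖x₀‖, sq_nonneg ‖x₁‖]

theorem exists_abs_halfProfile_norm_sub_le {s : ℝ} (hs : 0 < s) (x₀ x₁ : E3) : ∃ K : ℝ, 0 < K ∧
    ∀ (x : E3) (a : ℝ),
      |halfProfile (‖x₀ - x‖ ^ 2) (s + a ^ 2) - halfProfile (‖x₁ - x‖ ^ 2) (s + a ^ 2)| ≤
        K * (1 + ‖x‖ ^ 2 + a ^ 2) ^ (-((3 / 2 : ℝ) + 1)) := by
  obtain ⟨C, hC, h⟩ := exists_abs_halfProfile_sub_le
  obtain ⟨D, hD, hd⟩ := exists_abs_norm_sq_sub_le x₀ x₁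
  obtain ⟨M₀, hM₀, h₀⟩ := exists_one_add_norm_sq_le hs x₀
  obtain ⟨M₁, hM₁, h₁⟩ := exists_one_add_norm_sq_le hs x₁
  set M := M₀ + M₁
  have hM : 1 ≤ M := by simp only [M]; linarith
  refine ⟨C * D * M ^ 3, by positivity, fun x a => ?_⟩
  set ω := 1 + ‖x‖ ^ 2 with hω
  have hω0 : 0 < ω := by positivity
  set m := (ω + a ^ 2) / M with hm
  have hm0 : 0 < m := by positivity
  have ha : 0 ≤ a ^ 2 := sq_nonneg a
  have lower : ∀ N c : ℝ, N ≤ M → 0 ≤ c → ω ≤ N * (s + c) → m ≤ s + a ^ 2 + c := by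
    intro N c hN hc hle
    rw [hm, div_le_iff₀ (by positivity)]
    nlinarith [mul_le_mul_of_nonneg_right hN (by positivity : 0 ≤ s + c)]
  have hb := h (s + a ^ 2) m (‖x₀ - x‖ ^ 2) (‖x₁ - x‖ ^ 2) (by positivity) (by positivity)
    (by positivity) hm0 (lower M₀ _ (by simp only [M]; linarith) (by positivity) (h₀ x))
    (lower M₁ _ (by simp only [M]; linarith) (by positivity) (h₁ x))
  refine hb.trans ?_
  have e : (m ^ 3)⁻¹ = M ^ 3 * (ω + a ^ 2) ^ (-3 : ℝ) := by
    rw [hm, div_pow, inv_div, Real.rpow_neg (by positivity), div_eq_mul_inv]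
    norm_cast
  calc C * |‖x₀ - x‖ ^ 2 - ‖x₁ - x‖ ^ 2| * (m ^ 3)⁻¹
      ≤ C * (D * (ω + a ^ 2) ^ (1 / 2 : ℝ)) * (m ^ 3)⁻¹ := by
        gcongr
        exact (hd x).trans (mul_le_mul_of_nonneg_left (Real.rpow_le_rpow hω0.le
          (le_add_of_nonneg_right ha) (by norm_num)) hD.le)
    _ = C * D * M ^ 3 * ((ω + a ^ 2) ^ (1 / 2 : ℝ) * (ω + a ^ 2) ^ (-3 : ℝ)) := by rw [e]; ring
    _ = _ := by rw [← Real.rpow_add (by positivity)]; norm_num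

/-- `w` is integrable against the weight `(1 + ‖x‖²)⁻²`. -/
def WeightedIntegrable (w : E3 → ℝ) : Prop :=
  Integrable fun x => w x * ((1 + ‖x‖ ^ 2) ^ 2)⁻¹

theorem WeightedIntegrable.integrable_mul {w k : E3 → ℝ} (hw : WeightedIntegrable w)
    (hwc : Continuous w) (hk : Measurable k) {K : ℝ}
    (hb : ∀ x, |k x| ≤ K * ((1 + ‖x‖ ^ 2) ^ 2)⁻¹) : Integrable fun x => w x * k x := by
  refine (hw.norm.const_mul K).mono' (hwc.measurable.mul hk).aestronglyMeasurable
    (Eventually.of_forall fun x => ?_)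
  rw [norm_mul, norm_mul, Real.norm_eq_abs (k x),
    Real.norm_of_nonneg (by positivity : 0 ≤ ((1 + ‖x‖ ^ 2) ^ 2)⁻¹)]
  calc ‖w x‖ * |k x| ≤ ‖w x‖ * (K * ((1 + ‖x‖ ^ 2) ^ 2)⁻¹) := by gcongr; exact hb x
    _ = _ := by ring

theorem inv_sq_add_norm_sub_le {s M : ℝ} {x₀ x : E3} (hM : 1 ≤ M)
    (h : 1 + ‖x‖ ^ 2 ≤ M * (s + ‖x₀ - x‖ ^ 2)) :
    ((s + ‖x₀ - x‖ ^ 2) ^ 2)⁻¹ ≤ M ^ 2 * ((1 + ‖x‖ ^ 2) ^ 2)⁻¹ := by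
  have h0 : 0 < M * (s + ‖x₀ - x‖ ^ 2) := lt_of_lt_of_le (by positivity) h
  have h1 : 0 < s + ‖x₀ - x‖ ^ 2 := pos_of_mul_pos_right h0 (by linarith)
  rw [← div_eq_mul_inv, inv_eq_one_div, div_le_div_iff₀ (by positivity) (by positivity), one_mul,
    ← mul_pow]
  gcongr

theorem measurable_halfProfile_norm_sub (r : ℝ) (x₀ : E3) :
    Measurable fun x : E3 => halfProfile (‖x₀ - x‖ ^ 2) r :=
  measurable_halfProfile.comp (Measurable.prodMk (by fun_prop) measurable_const)

theorem measurable_gaussProfile_norm_sub (r : ℝ) (x₀ : E3) :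
    Measurable fun x : E3 => gaussProfile (‖x₀ - x‖ ^ 2) r :=
  measurable_gaussProfile.comp (Measurable.prodMk (by fun_prop) measurable_const)

theorem integrable_mul_halfProfile {w : E3 → ℝ} (hw : WeightedIntegrable w) (hwc : Continuous w)
    {r : ℝ} (hr : 0 < r) (x₀ : E3) :
    Integrable fun x => w x * halfProfile (‖x₀ - x‖ ^ 2) r := by
  obtain ⟨C, hC, h⟩ := exists_abs_halfProfile_le
  obtain ⟨M, hM, hx⟩ := exists_one_add_norm_sq_le hr x₀
  refine hw.integrable_mul hwc (measurable_halfProfile_norm_sub r x₀) (K := C * M ^ 2) fun x => ?_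
  refine (h r _ hr (by positivity)).trans ?_
  rw [mul_assoc]
  gcongr
  exact inv_sq_add_norm_sub_le hM (hx x)

theorem exists_gaussProfile_le_sqrt : ∃ C : ℝ, 0 < C ∧ ∀ r c : ℝ, 0 < r → 0 ≤ c →
    gaussProfile c r ≤ C * r ^ (1 / 2 : ℝ) * ((r + c) ^ 2)⁻¹ := by
  obtain ⟨C, hC, h⟩ := exists_rpow_mul_pow_mul_exp_le 2 0
  refine ⟨C, hC, fun r c hr hc => ?_⟩
  have h1 := h r c hr hc
  rw [pow_zero, mul_one, Real.rpow_neg (by positivity : 0 ≤ r + c)] at h1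
  have e : gaussProfile c r = r ^ (1 / 2 : ℝ) * (r ^ (-2 : ℝ) * exp (-(c / r))) := by
    rw [gaussProfile, ← mul_assoc, ← Real.rpow_add hr]; norm_num
  rw [Real.rpow_ofNat] at h1
  calc gaussProfile c r ≤ r ^ (1 / 2 : ℝ) * (C * ((r + c) ^ 2)⁻¹) := by
        rw [e]; exact mul_le_mul_of_nonneg_left h1 (by positivity)
    _ = _ := by ring

theorem integrable_mul_gaussProfile {w : E3 → ℝ} (hw : WeightedIntegrable w) (hwc : Continuous w)
    {r : ℝ} (hr : 0 < r) (x₀ : E3) :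
    Integrable fun x => w x * gaussProfile (‖x₀ - x‖ ^ 2) r := by
  obtain ⟨C, hC, h⟩ := exists_gaussProfile_le_sqrt
  obtain ⟨M, hM, hx⟩ := exists_one_add_norm_sq_le hr x₀
  refine hw.integrable_mul hwc (measurable_gaussProfile_norm_sub r x₀)
    (K := C * r ^ (1 / 2 : ℝ) * M ^ 2) fun x => ?_
  rw [abs_of_nonneg (gaussProfile_nonneg _ hr.le)]
  refine (h r _ hr (by positivity)).trans ?_
  rw [mul_assoc (C * _)]
  gcongr
  exact inv_sq_add_norm_sub_le hM (hx x)

theorem integrable_prod_halfProfile_sub {w : E3 → ℝ} (hw : WeightedIntegrable w)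
    (hwc : Continuous w) {s : ℝ} (hs : 0 < s) (x₀ x₁ : E3) :
    Integrable (fun p : E3 × ℝ => w p.1 * (halfProfile (‖x₀ - p.1‖ ^ 2) (s + p.2 ^ 2) -
      halfProfile (‖x₁ - p.1‖ ^ 2) (s + p.2 ^ 2))) (volume.prod volume) := by
  obtain ⟨K, hK, h⟩ := exists_abs_halfProfile_norm_sub_le hs x₀ x₁
  have hmeas : ∀ y : E3, Measurable fun p : E3 × ℝ =>
      halfProfile (‖y - p.1‖ ^ 2) (s + p.2 ^ 2) := fun y =>
    measurable_halfProfile.comp (Measurable.prodMk (by fun_prop) (by fun_prop))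
  have hm : Measurable fun p : E3 × ℝ => w p.1 * (halfProfile (‖x₀ - p.1‖ ^ 2) (s + p.2 ^ 2) -
      halfProfile (‖x₁ - p.1‖ ^ 2) (s + p.2 ^ 2)) :=
    (hwc.measurable.comp measurable_fst).mul ((hmeas x₀).sub (hmeas x₁))
  have hi : ∀ x : E3, Integrable fun a : ℝ => halfProfile (‖x₀ - x‖ ^ 2) (s + a ^ 2) -
      halfProfile (‖x₁ - x‖ ^ 2) (s + a ^ 2) := fun x =>
    (integrable_halfProfile_add_sq (by positivity) hs).sub
      (integrable_halfProfile_add_sq (by positivity) hs)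
  refine (integrable_prod_iff hm.aestronglyMeasurable).2
    ⟨Eventually.of_forall fun x => (hi x).const_mul (w x), ?_⟩
  refine (hw.norm.const_mul (K * π)).mono'
    hm.norm.stronglyMeasurable.integral_prod_right.aestronglyMeasurable
    (Eventually.of_forall fun x => ?_)
  rw [Real.norm_of_nonneg (integral_nonneg fun _ => norm_nonneg _), norm_mul,
    Real.norm_of_nonneg (by positivity : 0 ≤ ((1 + ‖x‖ ^ 2) ^ 2)⁻¹)]
  have hω : 0 < 1 + ‖x‖ ^ 2 := by positivity
  have hle := integral_add_sq_rpow_le hω (α := 3 / 2) (by norm_num)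
  simp_rw [norm_mul]
  rw [integral_const_mul]
  calc ‖w x‖ * ∫ a : ℝ, ‖halfProfile (‖x₀ - x‖ ^ 2) (s + a ^ 2) -
        halfProfile (‖x₁ - x‖ ^ 2) (s + a ^ 2)‖
      ≤ ‖w x‖ * ∫ a : ℝ, K * (1 + ‖x‖ ^ 2 + a ^ 2) ^ (-((3 / 2 : ℝ) + 1)) := by
        gcongr
        · exact (hi x).norm
        · exact (integrable_add_sq_rpow hω (by norm_num)).const_mul K
        · exact fun a => h x a
    _ ≤ ‖w x‖ * (K * (π * (1 + ‖x‖ ^ 2) ^ (-((3 / 2 : ℝ) + 1 / 2)))) := by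
        rw [integral_const_mul]
        gcongr
    _ = _ := by
        rw [Real.rpow_neg hω.le]
        norm_num
        ring

theorem integrable_prod_mul_gaussProfile {f : E3 → ℝ} (hf : Integrable f) {s : ℝ} (hs : 0 < s)
    (x₀ : E3) :
    Integrable (fun p : E3 × ℝ => f p.1 * gaussProfile (‖x₀ - p.1‖ ^ 2) (s + p.2 ^ 2))
      (volume.prod volume) := by
  have h := (hf.norm).mul_prod (integrable_add_sq_rpow hs (α := 1 / 2) (by norm_num))
  refine h.mono' ?_ (Eventually.of_forall fun p => ?_)
  · have hm : Measurable fun p : E3 × ℝ => gaussProfile (‖x₀ - p.1‖ ^ 2) (s + p.2 ^ 2) :=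
      measurable_gaussProfile.comp (Measurable.prodMk (by fun_prop) (by fun_prop))
    exact hf.1.comp_fst.mul hm.aestronglyMeasurable
  · have hp : 0 < s + p.2 ^ 2 := by positivity
    rw [norm_mul, Real.norm_of_nonneg (gaussProfile_nonneg _ hp.le)]
    gcongr
    refine (gaussProfile_le (by positivity) hp).trans_eq ?_
    norm_num

theorem gaussMean_sub_eq {w f : E3 → ℝ} (hw : WeightedIntegrable w) (hwc : Continuous w)
    (hf : Integrable f) {κ : ℝ}
    (h : ∀ r, 0 < r → ∀ x₀ : E3, κ * ∫ x, w x * halfProfile (‖x₀ - x‖ ^ 2) r =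
      ∫ x, f x * gaussProfile (‖x₀ - x‖ ^ 2) r) {s : ℝ} (hs : 0 < s) (x₀ x₁ : E3) :
    κ * π * ((∫ x, w x * gaussProfile (‖x₀ - x‖ ^ 2) s) -
        ∫ x, w x * gaussProfile (‖x₁ - x‖ ^ 2) s) =
      (∫ x, f x * rieszProfile (‖x₀ - x‖ ^ 2) s) - ∫ x, f x * rieszProfile (‖x₁ - x‖ ^ 2) s := by
  have hL := integral_integral_swap (f := fun (x : E3) (a : ℝ) =>
    w x * (halfProfile (‖x₀ - x‖ ^ 2) (s + a ^ 2) - halfProfile (‖x₁ - x‖ ^ 2) (s + a ^ 2)))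
    (integrable_prod_halfProfile_sub hw hwc hs x₀ x₁)
  have hR : ∀ y : E3, ∫ a : ℝ, ∫ x, f x * gaussProfile (‖y - x‖ ^ 2) (s + a ^ 2) =
      ∫ x, f x * rieszProfile (‖y - x‖ ^ 2) s := fun y => by
    rw [← integral_integral_swap
      (f := fun (x : E3) (a : ℝ) => f x * gaussProfile (‖y - x‖ ^ 2) (s + a ^ 2))
      (integrable_prod_mul_gaussProfile hf hs y)]
    simp_rw [integral_const_mul]
    rfl
  have hRi : ∀ y : E3, Integrable fun a : ℝ =>
      ∫ x, f x * gaussProfile (‖y - x‖ ^ 2) (s + a ^ 2) := fun y =>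
    (integrable_prod_mul_gaussProfile hf hs y).integral_prod_right
  have e1 : ∀ x : E3, ∫ a : ℝ, w x * (halfProfile (‖x₀ - x‖ ^ 2) (s + a ^ 2) -
      halfProfile (‖x₁ - x‖ ^ 2) (s + a ^ 2)) =
      π * (w x * gaussProfile (‖x₀ - x‖ ^ 2) s - w x * gaussProfile (‖x₁ - x‖ ^ 2) s) := by
    intro x
    rw [integral_const_mul, integral_sub (integrable_halfProfile_add_sq (by positivity) hs)
      (integrable_halfProfile_add_sq (by positivity) hs),
      integral_halfProfile_add_sq (by positivity) hs, integral_halfProfile_add_sq (by positivity) hs]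
    ring
  have e2 : ∀ a : ℝ, κ * ∫ x, w x * (halfProfile (‖x₀ - x‖ ^ 2) (s + a ^ 2) -
      halfProfile (‖x₁ - x‖ ^ 2) (s + a ^ 2)) =
      (∫ x, f x * gaussProfile (‖x₀ - x‖ ^ 2) (s + a ^ 2)) -
        ∫ x, f x * gaussProfile (‖x₁ - x‖ ^ 2) (s + a ^ 2) := by
    intro a
    have ha : 0 < s + a ^ 2 := by positivity
    simp_rw [mul_sub]
    rw [integral_sub (integrable_mul_halfProfile hw hwc ha x₀)
      (integrable_mul_halfProfile hw hwc ha x₁), mul_sub, h _ ha, h _ ha]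
  simp_rw [e1] at hL
  rw [integral_const_mul, integral_sub (integrable_mul_gaussProfile hw hwc hs x₀)
    (integrable_mul_gaussProfile hw hwc hs x₁)] at hL
  rw [mul_assoc, hL, ← integral_const_mul, ← hR, ← hR, ← integral_sub (hRi x₀) (hRi x₁)]
  simp_rw [e2]

theorem integrable_mul_inv_norm_sub_sq {f : E3 → ℝ} (hfc : Continuous f) (hf : Integrable f)
    (x : E3) : Integrable fun y => f y * (‖x - y‖ ^ 2)⁻¹ := by
  obtain ⟨B, hB⟩ := (isCompact_closedBall x 1).exists_bound_of_continuousOn hfc.continuousOn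
  have hB0 : 0 ≤ B := (norm_nonneg _).trans (hB x (Metric.mem_closedBall_self zero_le_one))
  have hk := (integrable_norm_sq_inv_mul.comp_sub_left x).const_mul (2 * B)
  refine (hk.add hf.norm).mono' ?_ (Eventually.of_forall fun y => ?_)
  · exact hf.1.mul (Measurable.aestronglyMeasurable (by fun_prop))
  · simp only [Pi.add_apply]
    rw [norm_mul, norm_inv, norm_pow, norm_norm]
    rcases le_total ‖x - y‖ 1 with h | h
    · have h1 : ‖f y‖ ≤ B := hB y (by rwa [Metric.mem_closedBall, dist_eq_norm, norm_sub_rev])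
      have h2 : 1 ≤ 2 * (1 + ‖x - y‖ ^ 2)⁻¹ := by
        rw [← div_eq_mul_inv, le_div_iff₀ (by positivity)]
        nlinarith [norm_nonneg (x - y)]
      calc ‖f y‖ * (‖x - y‖ ^ 2)⁻¹ ≤ B * ((‖x - y‖ ^ 2)⁻¹ * (2 * (1 + ‖x - y‖ ^ 2)⁻¹)) := by
            gcongr
            exact le_mul_of_one_le_right (by positivity) h2
        _ = 2 * B * ((‖x - y‖ ^ 2)⁻¹ * (1 + ‖x - y‖ ^ 2)⁻¹) := by ring
        _ ≤ _ := le_add_of_nonneg_right (norm_nonneg _)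
    · have h1 : (‖x - y‖ ^ 2)⁻¹ ≤ 1 := inv_le_one_of_one_le₀ (one_le_pow₀ h)
      calc ‖f y‖ * (‖x - y‖ ^ 2)⁻¹ ≤ ‖f y‖ := mul_le_of_le_one_right (norm_nonneg _) h1
        _ ≤ _ := le_add_of_nonneg_left (by positivity)

theorem tendsto_integral_mul_rieszProfile {f : E3 → ℝ} (hfc : Continuous f) (hf : Integrable f)
    (x : E3) : Tendsto (fun s => ∫ y, f y * rieszProfile (‖x - y‖ ^ 2) s)
      (nhdsWithin 0 (Set.Ioi 0)) (nhds (∫ y, f y * (‖x - y‖ ^ 2)⁻¹)) := by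
  obtain ⟨C, hC, h⟩ := exists_abs_rieszProfile_le
  have hx : ∀ᵐ y : E3, y ≠ x := compl_mem_ae_iff.2 (measure_singleton x)
  refine tendsto_integral_filter_of_dominated_convergence
    (fun y => C * ‖f y * (‖x - y‖ ^ 2)⁻¹‖) ?_ ?_
    ((integrable_mul_inv_norm_sub_sq hfc hf x).norm.const_mul C) ?_
  · refine Eventually.of_forall fun s => hf.1.mul (Measurable.aestronglyMeasurable ?_)
    exact measurable_rieszProfile.comp (Measurable.prodMk (by fun_prop) measurable_const)
  · filter_upwards [self_mem_nhdsWithin] with s hs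
    have hs : 0 < s := hs
    filter_upwards [hx] with y hy
    have hc : 0 < ‖x - y‖ ^ 2 := by
      have := norm_pos_iff.2 (sub_ne_zero.2 hy.symm)
      positivity
    rw [norm_mul, norm_mul, mul_left_comm, Real.norm_of_nonneg (inv_nonneg.2 hc.le)]
    gcongr
    refine (h s _ hs hc.le).trans ?_
    gcongr
    linarith
  · filter_upwards [hx] with y hy
    have hc : 0 < ‖x - y‖ ^ 2 := by
      have := norm_pos_iff.2 (sub_ne_zero.2 hy.symm)
      positivity
    exact (tendsto_rieszProfile hc).const_mul _

theorem tendsto_inv_sqrt_nhdsGT_zero :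
    Tendsto (fun s : ℝ => (√s)⁻¹) (nhdsWithin 0 (Set.Ioi 0)) atTop := by
  refine tendsto_inv_nhdsGT_zero.comp (tendsto_nhdsWithin_iff.2 ⟨?_, ?_⟩)
  · have h : Tendsto (fun s : ℝ => √s) (nhds 0) (nhds (√0)) := Real.continuous_sqrt.tendsto 0
    rw [Real.sqrt_zero] at h
    exact h.mono_left nhdsWithin_le_nhds
  · filter_upwards [self_mem_nhdsWithin] with s hs using Real.sqrt_pos.2 hs

theorem tendsto_integral_gaussProfile_mul {g : E3 → ℝ} {x : E3} (hg : Integrable g)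
    (hgc : ContinuousAt g x) :
    Tendsto (fun s => ∫ y, g y * gaussProfile (‖x - y‖ ^ 2) s) (nhdsWithin 0 (Set.Ioi 0))
      (nhds (π ^ (3 / 2 : ℝ) * g x)) := by
  have hπ : (0:ℝ) < π ^ (3 / 2 : ℝ) := by positivity
  have hInt : ∫ z : E3, exp (-‖z‖ ^ 2) = π ^ (3 / 2 : ℝ) := by
    have := integral_exp_neg_norm_sq_div zero_lt_one
    simpa using this
  have hdecay : Tendsto (fun z : E3 => ‖z‖ ^ Module.finrank ℝ E3 *
      ((π ^ (3 / 2 : ℝ))⁻¹ * exp (-‖z‖ ^ 2))) (Bornology.cobounded E3) (nhds 0) := by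
    have h1 : Tendsto (fun t : ℝ => t ^ 3 * exp (-t)) atTop (nhds 0) :=
      Real.tendsto_pow_mul_exp_neg_atTop_nhds_zero 3
    have h2 := (h1.comp (tendsto_norm_cobounded_atTop (E := E3))).const_mul (π ^ (3 / 2 : ℝ))⁻¹
    rw [mul_zero] at h2
    refine squeeze_zero' (Eventually.of_forall fun z => by positivity) ?_ h2
    filter_upwards [tendsto_norm_cobounded_atTop.eventually_ge_atTop 1] with z hz
    have h3 : exp (-‖z‖ ^ 2) ≤ exp (-‖z‖) := exp_le_exp.2 (by nlinarith)
    simp only [Function.comp_apply, finrank_euclideanSpace_fin]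
    rw [mul_left_comm]
    gcongr
  have key := (tendsto_integral_comp_smul_smul_of_integrable' (μ := (volume : Measure E3))
    (φ := fun z => (π ^ (3 / 2 : ℝ))⁻¹ * exp (-‖z‖ ^ 2)) (fun z => by positivity)
    (by rw [integral_const_mul, hInt, inv_mul_cancel₀ hπ.ne']) hdecay hg hgc).comp
    tendsto_inv_sqrt_nhdsGT_zero
  refine (key.const_mul (π ^ (3 / 2 : ℝ))).congr' ?_
  filter_upwards [self_mem_nhdsWithin] with s hs
  have hs : 0 < s := hs
  simp only [Function.comp_apply]
  rw [← integral_const_mul]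
  congr 1 with y
  have e1 : s ^ (-(3 / 2) : ℝ) = (√s)⁻¹ ^ 3 := by
    rw [Real.sqrt_eq_rpow, ← Real.rpow_neg hs.le, ← Real.rpow_natCast, ← Real.rpow_mul hs.le]
    norm_num
  have e2 : ‖(√s)⁻¹ • (x - y)‖ ^ 2 = ‖x - y‖ ^ 2 / s := by
    rw [norm_smul, mul_pow, Real.norm_of_nonneg (by positivity), inv_pow, Real.sq_sqrt hs.le]
    ring
  rw [gaussProfile, e1, e2, finrank_euclideanSpace_fin, smul_eq_mul]
  field_simp

theorem tendsto_integral_gaussProfile_far {w : E3 → ℝ} (hw : WeightedIntegrable w) (x : E3) :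
    Tendsto (fun s => ∫ y in (Metric.ball x 1)ᶜ, w y * gaussProfile (‖x - y‖ ^ 2) s)
      (nhdsWithin 0 (Set.Ioi 0)) (nhds 0) := by
  obtain ⟨C, hC, h⟩ := exists_gaussProfile_le_sqrt
  obtain ⟨M, hM, hx⟩ := exists_one_add_norm_sq_le one_pos x
  set I := ∫ y, ‖w y * ((1 + ‖y‖ ^ 2) ^ 2)⁻¹‖
  have hlim : Tendsto (fun s : ℝ => C * s ^ (1 / 2 : ℝ) * (2 * M) ^ 2 * I)
      (nhdsWithin 0 (Set.Ioi 0)) (nhds 0) := by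
    have h1 : Tendsto (fun s : ℝ => s ^ (1 / 2 : ℝ)) (nhds 0) (nhds (0 ^ (1 / 2 : ℝ))) :=
      (Real.continuous_rpow_const (by norm_num)).tendsto 0
    rw [Real.zero_rpow (by norm_num)] at h1
    have h2 := (((h1.mono_left (nhdsWithin_le_nhds (s := Set.Ioi 0))).const_mul C).mul_const
      ((2 * M) ^ 2)).mul_const I
    simpa using h2
  refine squeeze_zero_norm' ?_ hlim
  filter_upwards [self_mem_nhdsWithin] with s hs
  have hs : 0 < s := hs
  have hb : ∀ y ∈ (Metric.ball x 1)ᶜ, ‖w y * gaussProfile (‖x - y‖ ^ 2) s‖ ≤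
      C * s ^ (1 / 2 : ℝ) * (2 * M) ^ 2 * ‖w y * ((1 + ‖y‖ ^ 2) ^ 2)⁻¹‖ := by
    intro y hy
    have hy1 : 1 ≤ ‖x - y‖ := by
      simpa [Metric.mem_ball, dist_eq_norm, norm_sub_rev] using hy
    have hy2 : 1 ≤ ‖x - y‖ ^ 2 := one_le_pow₀ hy1
    have h1 : 1 + ‖y‖ ^ 2 ≤ 2 * M * (s + ‖x - y‖ ^ 2) := by
      refine (hx y).trans ?_
      rw [mul_comm 2 M, mul_assoc]
      gcongr
      linarith
    rw [norm_mul, norm_mul, Real.norm_of_nonneg (gaussProfile_nonneg _ hs.le),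
      Real.norm_of_nonneg (by positivity : 0 ≤ ((1 + ‖y‖ ^ 2) ^ 2)⁻¹)]
    calc ‖w y‖ * gaussProfile (‖x - y‖ ^ 2) s
        ≤ ‖w y‖ * (C * s ^ (1 / 2 : ℝ) * ((2 * M) ^ 2 * ((1 + ‖y‖ ^ 2) ^ 2)⁻¹)) := by
          gcongr
          refine (h s _ hs (by positivity)).trans ?_
          gcongr
          exact inv_sq_add_norm_sub_le (by linarith) h1
      _ = _ := by ring
  calc ‖∫ y in (Metric.ball x 1)ᶜ, w y * gaussProfile (‖x - y‖ ^ 2) s‖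
      ≤ ∫ y in (Metric.ball x 1)ᶜ,
        C * s ^ (1 / 2 : ℝ) * (2 * M) ^ 2 * ‖w y * ((1 + ‖y‖ ^ 2) ^ 2)⁻¹‖ :=
        norm_integral_le_of_norm_le (hw.norm.const_mul _).integrableOn
          ((ae_restrict_iff' measurableSet_ball.compl).2 (Eventually.of_forall hb))
    _ ≤ ∫ y, C * s ^ (1 / 2 : ℝ) * (2 * M) ^ 2 * ‖w y * ((1 + ‖y‖ ^ 2) ^ 2)⁻¹‖ :=
        setIntegral_le_integral (hw.norm.const_mul _) (Eventually.of_forall fun y => by positivity)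
    _ = _ := integral_const_mul _ _

theorem tendsto_gaussMean {w : E3 → ℝ} (hw : WeightedIntegrable w) (hwc : Continuous w) (x : E3) :
    Tendsto (fun s => ∫ y, w y * gaussProfile (‖x - y‖ ^ 2) s) (nhdsWithin 0 (Set.Ioi 0))
      (nhds (π ^ (3 / 2 : ℝ) * w x)) := by
  have hball : Metric.ball x 1 ∈ nhds x := Metric.ball_mem_nhds x one_pos
  have hg : Integrable ((Metric.ball x 1).indicator w) :=
    (integrable_indicator_iff measurableSet_ball).2
      ((hwc.continuousOn.integrableOn_compact (isCompact_closedBall x 1)).mono_set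
        Metric.ball_subset_closedBall)
  have hgc : ContinuousAt ((Metric.ball x 1).indicator w) x :=
    hwc.continuousAt.congr
      (eventuallyEq_of_mem hball fun y hy => (Set.indicator_of_mem hy w).symm)
  have key := (tendsto_integral_gaussProfile_mul hg hgc).add
    (tendsto_integral_gaussProfile_far hw x)
  rw [Set.indicator_of_mem (mem_of_mem_nhds hball), add_zero] at key
  refine key.congr' ?_
  filter_upwards [self_mem_nhdsWithin] with s hs
  have hi := integrable_mul_gaussProfile hw hwc (r := s) hs x
  rw [← integral_add_compl (measurableSet_ball (x := x) (ε := 1)) hi,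
    ← integral_indicator measurableSet_ball]
  congr 2 with y
  simp only [Set.indicator]
  split_ifs <;> simp

theorem neg_lap_sub_eq {w f : E3 → ℝ} (hw : WeightedIntegrable w) (hwc : Continuous w)
    (hf : Integrable f) (hfc : Continuous f) {κ : ℝ}
    (h : ∀ r, 0 < r → ∀ x₀ : E3, κ * ∫ x, w x * halfProfile (‖x₀ - x‖ ^ 2) r =
      ∫ x, f x * gaussProfile (‖x₀ - x‖ ^ 2) r) (x₀ x₁ : E3) :
    κ * π * (π ^ (3 / 2 : ℝ) * w x₀ - π ^ (3 / 2 : ℝ) * w x₁) =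
      (∫ y, f y * (‖x₀ - y‖ ^ 2)⁻¹) - ∫ y, f y * (‖x₁ - y‖ ^ 2)⁻¹ := by
  refine tendsto_nhds_unique
    (((tendsto_gaussMean hw hwc x₀).sub (tendsto_gaussMean hw hwc x₁)).const_mul (κ * π)) ?_
  refine ((tendsto_integral_mul_rieszProfile hfc hf x₀).sub
    (tendsto_integral_mul_rieszProfile hfc hf x₁)).congr' ?_
  filter_upwards [self_mem_nhdsWithin] with s hs
  exact (gaussMean_sub_eq hw hwc hf h hs x₀ x₁).symm

theorem hasDerivAt_max_zero_sq (t : ℝ) : HasDerivAt (fun t : ℝ => max 0 t ^ 2) (2 * max 0 t) t := by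
  have hne : ∀ y : ℝ, y ≠ 0 → HasDerivAt (fun t : ℝ => max 0 t ^ 2) (2 * max 0 y) y := by
    intro y hy
    rcases hy.lt_or_gt with h | h
    · rw [max_eq_left h.le, mul_zero]
      refine (hasDerivAt_const y (0:ℝ)).congr_of_eventuallyEq ?_
      filter_upwards [Iio_mem_nhds h] with t ht
      simp [max_eq_left (Set.mem_Iio.1 ht).le]
    · rw [max_eq_right h.le]
      have h1 : HasDerivAt (fun t : ℝ => t ^ 2) (2 * y) y := by simpa using hasDerivAt_pow 2 y
      refine h1.congr_of_eventuallyEq ?_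
      filter_upwards [Ioi_mem_nhds h] with t ht
      simp [max_eq_right (Set.mem_Ioi.1 ht).le]
  rcases eq_or_ne t 0 with rfl | ht
  · exact hasDerivAt_of_hasDerivAt_of_ne (g := fun y => 2 * max 0 y) hne
      (Continuous.continuousAt (by fun_prop)) (Continuous.continuousAt (by fun_prop))
  · exact hne t ht

/-- A nonnegative radial `C¹` function supported in the closed unit ball. -/
noncomputable def radialBump (x : E3) : ℝ := max 0 (1 - ‖x‖ ^ 2) ^ 2

/-- The nonnegative function `ψ` for which `∇ radialBump x = -ψ(x) x`. -/
noncomputable def radialBumpSlope (x : E3) : ℝ := 4 * max 0 (1 - ‖x‖ ^ 2)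

theorem hasFDerivAt_radialBump (x : E3) :
    HasFDerivAt radialBump (-radialBumpSlope x • innerSL ℝ x) x := by
  have h1 : HasFDerivAt (fun x : E3 => 1 - ‖x‖ ^ 2) (-(2 • innerSL ℝ x)) x :=
    (hasStrictFDerivAt_norm_sq x).hasFDerivAt.const_sub 1
  refine ((hasDerivAt_max_zero_sq (1 - ‖x‖ ^ 2)).comp_hasFDerivAt x h1).congr_fderiv ?_
  ext v
  simp [radialBumpSlope]
  ring

theorem continuous_radialBump : Continuous radialBump := by
  unfold radialBump; fun_prop

theorem continuous_radialBumpSlope : Continuous radialBumpSlope := by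
  unfold radialBumpSlope; fun_prop

theorem max_zero_one_sub_norm_sq_eq_zero {x : E3} (hx : x ∉ Metric.closedBall (0 : E3) 1) :
    max 0 (1 - ‖x‖ ^ 2) = 0 := by
  have h : 1 < ‖x‖ := by simpa using hx
  exact max_eq_left (by nlinarith)

theorem hasCompactSupport_radialBump : HasCompactSupport radialBump :=
  HasCompactSupport.intro (isCompact_closedBall 0 1) fun x hx => by
    simp [radialBump, max_zero_one_sub_norm_sq_eq_zero hx]

theorem hasCompactSupport_radialBumpSlope : HasCompactSupport radialBumpSlope :=
  HasCompactSupport.intro (isCompact_closedBall 0 1) fun x hx => by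
    simp [radialBumpSlope, max_zero_one_sub_norm_sq_eq_zero hx]

theorem radialBump_nonneg (x : E3) : 0 ≤ radialBump x := by unfold radialBump; positivity

theorem radialBumpSlope_nonneg (x : E3) : 0 ≤ radialBumpSlope x := by
  unfold radialBumpSlope; positivity

theorem radialBump_le_one (x : E3) : radialBump x ≤ 1 :=
  pow_le_one₀ (le_max_left _ _) (max_le zero_le_one (by nlinarith [norm_nonneg x]))

theorem radialBumpSlope_le (x : E3) : radialBumpSlope x ≤ 4 := by
  have : max 0 (1 - ‖x‖ ^ 2) ≤ 1 := max_le zero_le_one (by nlinarith [norm_nonneg x])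
  unfold radialBumpSlope
  linarith

theorem integrable_mul_radialBump {g : E3 → ℝ} (hg : Continuous g) :
    Integrable fun x => g x * radialBump x :=
  (hg.mul continuous_radialBump).integrable_of_hasCompactSupport
    hasCompactSupport_radialBump.mul_left

theorem integrable_mul_radialBumpSlope {g : E3 → ℝ} (hg : Continuous g) :
    Integrable fun x => g x * radialBumpSlope x :=
  (hg.mul continuous_radialBumpSlope).integrable_of_hasCompactSupport
    hasCompactSupport_radialBumpSlope.mul_left

theorem integral_radialBump_pos : 0 < ∫ x, radialBump x := by
  refine continuous_radialBump.integral_pos_of_hasCompactSupport_nonneg_nonzero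
    hasCompactSupport_radialBump radialBump_nonneg (x := 0) ?_
  simp [radialBump]

theorem continuous_fderiv_dilation {u : E3 → ℝ} (hu : ContDiff ℝ 2 u) (R : ℝ) :
    Continuous fun x => fderiv ℝ u (R • x) x :=
  ((hu.continuous_fderiv (by norm_num)).comp (continuous_const_smul R)).clm_apply continuous_id

theorem hasDerivAt_integral_dilation {u : E3 → ℝ} (hu : ContDiff ℝ 2 u) (R : ℝ) :
    HasDerivAt (fun R : ℝ => ∫ x, u (R • x) * radialBumpSlope x)
      (∫ x, fderiv ℝ u (R • x) x * radialBumpSlope x) R := by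
  have hfd : Continuous (fderiv ℝ u) := hu.continuous_fderiv (by norm_num)
  obtain ⟨K, hK⟩ := (isCompact_closedBall (0 : E3) (|R| + 1)).exists_bound_of_continuousOn
    hfd.continuousOn
  have hK0 : 0 ≤ K :=
    (norm_nonneg _).trans (hK 0 (Metric.mem_closedBall_self (by positivity)))
  have hcont : ∀ R : ℝ, Continuous fun x : E3 => u (R • x) := fun R =>
    hu.continuous.comp (continuous_const_smul R)
  refine (hasDerivAt_integral_of_dominated_loc_of_deriv_le
    (F' := fun (R : ℝ) (x : E3) => fderiv ℝ u (R • x) x * radialBumpSlope x)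
    (bound := fun x => K * radialBumpSlope x) (Metric.ball_mem_nhds R one_pos) ?_ ?_ ?_ ?_ ?_ ?_).2
  · exact Eventually.of_forall fun R =>
      (integrable_mul_radialBumpSlope (hcont R)).aestronglyMeasurable
  · exact integrable_mul_radialBumpSlope (hcont R)
  · exact (integrable_mul_radialBumpSlope (continuous_fderiv_dilation hu R)).aestronglyMeasurable
  · refine Eventually.of_forall fun x T hT => ?_
    rw [norm_mul, Real.norm_of_nonneg (radialBumpSlope_nonneg x)]
    by_cases hx : x ∈ Metric.closedBall (0 : E3) 1
    · have hx1 : ‖x‖ ≤ 1 := by simpa using hx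
      have hT1 : |T| ≤ |R| + 1 := by
        have h1 : |T - R| < 1 := by simpa [Real.dist_eq] using hT
        have h2 := abs_sub_abs_le_abs_sub T R
        linarith
      have h3 : ‖fderiv ℝ u (T • x)‖ ≤ K := by
        refine hK _ ?_
        rw [mem_closedBall_zero_iff, norm_smul, Real.norm_eq_abs]
        nlinarith [abs_nonneg T, norm_nonneg x]
      refine mul_le_mul_of_nonneg_right ?_ (radialBumpSlope_nonneg x)
      refine ((fderiv ℝ u (T • x)).le_opNorm x).trans ?_
      nlinarith [norm_nonneg x, norm_nonneg (fderiv ℝ u (T • x))]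
    · simp [radialBumpSlope, max_zero_one_sub_norm_sq_eq_zero hx]
  · exact integrable_mul_radialBumpSlope continuous_const
  · refine Eventually.of_forall fun x T _ => ?_
    have h1 : HasDerivAt (fun T : ℝ => T • x) x T := by
      simpa using (hasDerivAt_id T).smul_const x
    exact (((hu.differentiable (by norm_num) _).hasFDerivAt).comp_hasDerivAt T h1).mul_const _

theorem contDiff_fderiv_apply {u : E3 → ℝ} (hu : ContDiff ℝ 2 u) (v : E3) :
    ContDiff ℝ 1 fun y => fderiv ℝ u y v :=
  (hu.fderiv_right (m := 1) (by norm_num)).clm_apply contDiff_const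

theorem continuous_lap {u : E3 → ℝ} (hu : ContDiff ℝ 2 u) : Continuous (lap u) := by
  unfold lap
  refine continuous_finsetSum _ fun i _ => ?_
  exact ((contDiff_fderiv_apply hu _).continuous_fderiv (by norm_num)).clm_apply continuous_const

theorem integral_fderiv_dilation {u : E3 → ℝ} (hu : ContDiff ℝ 2 u) (R : ℝ) :
    ∫ x, fderiv ℝ u (R • x) x * radialBumpSlope x = R * ∫ x, lap u (R • x) * radialBump x := by
  set g : Fin 3 → E3 → ℝ := fun i y => fderiv ℝ u y (EuclideanSpace.single i 1)
  have hg : ∀ i, ContDiff ℝ 1 (g i) := fun i => contDiff_fderiv_apply hu _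
  have hgR : ∀ i, ContDiff ℝ 1 fun x => g i (R • x) := fun i =>
    (hg i).comp (contDiff_const_smul R)
  have hbump : ∀ i x, fderiv ℝ radialBump x (EuclideanSpace.single i 1) =
      -(radialBumpSlope x * x i) := fun i x => by
    rw [(hasFDerivAt_radialBump x).fderiv]
    simp [EuclideanSpace.inner_single_right]
  have hfd : ∀ i x, fderiv ℝ (fun x => g i (R • x)) x = R • fderiv ℝ (g i) (R • x) := fun i x =>
    fderiv_comp_smul _
  have hgc : ∀ i, Continuous fun x : E3 => g i (R • x) * x i := fun i =>
    (hgR i).continuous.mul (by fun_prop)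
  have hgfc : ∀ i, Continuous fun x =>
      fderiv ℝ (fun x => g i (R • x)) x (EuclideanSpace.single i 1) := fun i =>
    ((hgR i).continuous_fderiv (by norm_num)).clm_apply continuous_const
  have hparts : ∀ i, ∫ x, g i (R • x) * x i * radialBumpSlope x =
      ∫ x, fderiv ℝ (fun x => g i (R • x)) x (EuclideanSpace.single i 1) * radialBump x := by
    intro i
    have h := integral_mul_fderiv_eq_neg_fderiv_mul_of_integrable (μ := (volume : Measure E3))
      (f := fun x => g i (R • x)) (g := radialBump) (v := EuclideanSpace.single i 1)
      (integrable_mul_radialBump (hgfc i)) ?_ (integrable_mul_radialBump (hgR i).continuous)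
      (fun x _ => (hgR i).differentiable (by norm_num) x)
      (fun x _ => (hasFDerivAt_radialBump x).differentiableAt)
    · rw [← neg_inj, ← h, ← integral_neg]
      congr 1 with x
      rw [hbump]
      ring
    · refine (integrable_mul_radialBumpSlope (hgc i)).neg.congr (Eventually.of_forall fun x => ?_)
      simp only [Pi.neg_apply, hbump]
      ring
  have hsum : ∀ x : E3, fderiv ℝ u (R • x) x * radialBumpSlope x =
      ∑ i, g i (R • x) * x i * radialBumpSlope x := by
    intro x
    rw [← Finset.sum_mul]
    congr 1
    have hL : ∀ L : E3 →L[ℝ] ℝ, L x = ∑ i, L (EuclideanSpace.single i 1) * x i := fun L => by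
      conv_lhs => rw [← (EuclideanSpace.basisFun (Fin 3) ℝ).sum_repr x, map_sum]
      simp [mul_comm]
    exact hL _
  simp_rw [hsum]
  rw [integral_finsetSum _ fun i _ => integrable_mul_radialBumpSlope (hgc i)]
  simp_rw [hparts]
  rw [← integral_finsetSum _ fun i _ => integrable_mul_radialBump (hgfc i), ← integral_const_mul]
  congr 1 with x
  simp only [lap, hfd, g, Finset.sum_mul, Finset.mul_sum, smul_apply, smul_eq_mul, mul_assoc]

theorem integrable_radialBump : Integrable radialBump :=
  continuous_radialBump.integrable_of_hasCompactSupport hasCompactSupport_radialBump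

theorem exists_integral_radialBump_mul_inv_norm_sub_sq_le :
    ∃ T, 0 ≤ T ∧ ∀ v : E3, ∫ x, radialBump x * (‖v - x‖ ^ 2)⁻¹ ≤ T := by
  set k : E3 → ℝ := fun z => (‖z‖ ^ 2)⁻¹ * (1 + ‖z‖ ^ 2)⁻¹
  have hk : Integrable k := integrable_norm_sq_inv_mul
  have hk0 : ∀ z, 0 ≤ k z := fun z => by positivity
  refine ⟨2 * (∫ z, k z) + ∫ x, radialBump x, ?_, fun v => ?_⟩
  · exact add_nonneg (mul_nonneg zero_le_two (integral_nonneg hk0))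
      (integral_nonneg radialBump_nonneg)
  · rw [← integral_sub_left_eq_self k volume v, ← integral_const_mul,
      ← integral_add ((hk.comp_sub_left v).const_mul 2) integrable_radialBump]
    refine integral_mono (integrable_mul_inv_norm_sub_sq continuous_radialBump
      integrable_radialBump v) (((hk.comp_sub_left v).const_mul 2).add integrable_radialBump)
      fun x => ?_
    have h0 := radialBump_nonneg x
    rcases le_total ‖v - x‖ 1 with h | h
    · have h2 : 1 ≤ 2 * (1 + ‖v - x‖ ^ 2)⁻¹ := by
        rw [← div_eq_mul_inv, le_div_iff₀ (by positivity)]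
        nlinarith [norm_nonneg (v - x)]
      calc radialBump x * (‖v - x‖ ^ 2)⁻¹
          ≤ 1 * ((‖v - x‖ ^ 2)⁻¹ * (2 * (1 + ‖v - x‖ ^ 2)⁻¹)) := by
            gcongr
            · exact radialBump_le_one x
            · exact le_mul_of_one_le_right (by positivity) h2
        _ = 2 * k (v - x) := by simp only [k]; ring
        _ ≤ _ := le_add_of_nonneg_right h0
    · exact (mul_le_of_le_one_right h0 (inv_le_one_of_one_le₀ (one_le_pow₀ h))).trans
        (le_add_of_nonneg_left (mul_nonneg zero_le_two (hk0 _)))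

theorem exists_integral_potential_mul_radialBump_le {f : E3 → ℝ} (hfc : Continuous f)
    (hf : Integrable f) (hf0 : ∀ y, 0 ≤ f y) :
    ∃ C, 0 ≤ C ∧ ∀ R, 0 < R →
      Integrable (fun x => (∫ y, f y * (‖R • x - y‖ ^ 2)⁻¹) * radialBump x) ∧
      ∫ x, (∫ y, f y * (‖R • x - y‖ ^ 2)⁻¹) * radialBump x ≤ C / R ^ 2 := by
  obtain ⟨T, hT0, hT⟩ := exists_integral_radialBump_mul_inv_norm_sub_sq_le
  refine ⟨T * ∫ y, f y, mul_nonneg hT0 (integral_nonneg hf0), fun R hR => ?_⟩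
  set F : E3 × E3 → ℝ := fun p => f p.1 * (‖R • p.2 - p.1‖ ^ 2)⁻¹ * radialBump p.2
  have hF0 : ∀ p, 0 ≤ F p := fun p =>
    mul_nonneg (mul_nonneg (hf0 _) (by positivity)) (radialBump_nonneg _)
  have hFm : Measurable F :=
    ((hfc.measurable.comp measurable_fst).mul (by fun_prop)).mul
      (continuous_radialBump.measurable.comp measurable_snd)
  have hFeq : ∀ y x, F (y, x) = f y * (R ^ 2)⁻¹ * (radialBump x * (‖R⁻¹ • y - x‖ ^ 2)⁻¹) := by
    intro y x
    have h : ‖R • x - y‖ = R * ‖R⁻¹ • y - x‖ := by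
      rw [norm_sub_rev, ← abs_of_pos hR, ← Real.norm_eq_abs, ← norm_smul, Real.norm_eq_abs,
        abs_of_pos hR, smul_sub, smul_inv_smul₀ hR.ne']
    simp only [F, h, mul_pow, mul_inv]
    ring
  have hFint : ∀ y, Integrable fun x => F (y, x) := fun y => by
    simp_rw [hFeq]
    exact (integrable_mul_inv_norm_sub_sq continuous_radialBump integrable_radialBump _).const_mul _
  have hFle : ∀ y, ∫ x, F (y, x) ≤ (T * (R ^ 2)⁻¹) * f y := fun y => by
    simp_rw [hFeq]
    rw [integral_const_mul]
    calc _ ≤ f y * (R ^ 2)⁻¹ * T :=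
          mul_le_mul_of_nonneg_left (hT _) (mul_nonneg (hf0 y) (by positivity))
      _ = _ := by ring
  have hFle' : Integrable fun y => ∫ x, F (y, x) :=
    (hf.const_mul (T * (R ^ 2)⁻¹)).mono' hFm.aestronglyMeasurable.integral_prod_right'
      (Eventually.of_forall fun y => by
        rw [Real.norm_of_nonneg (integral_nonneg fun x => hF0 _)]
        exact hFle y)
  have hFprod : Integrable F (volume.prod volume) := by
    rw [integrable_prod_iff hFm.aestronglyMeasurable]
    refine ⟨Eventually.of_forall hFint, ?_⟩
    simpa only [Real.norm_of_nonneg (hF0 _)] using hFle'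
  have hinner : ∀ x, ∫ y, F (y, x) = (∫ y, f y * (‖R • x - y‖ ^ 2)⁻¹) * radialBump x := fun x =>
    integral_mul_const (radialBump x) fun y => f y * (‖R • x - y‖ ^ 2)⁻¹
  have hInt := hFprod.integral_prod_right
  simp only [hinner] at hInt
  refine ⟨hInt, ?_⟩
  calc ∫ x, (∫ y, f y * (‖R • x - y‖ ^ 2)⁻¹) * radialBump x = ∫ x, ∫ y, F (y, x) := by
        simp only [hinner]
    _ = ∫ y, ∫ x, F (y, x) := (integral_integral_swap (f := fun y x => F (y, x)) hFprod).symm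
    _ ≤ ∫ y, T * (R ^ 2)⁻¹ * f y := integral_mono hFle' (hf.const_mul _) hFle
    _ = T * (∫ y, f y) / R ^ 2 := by rw [integral_const_mul]; ring

theorem integral_dilation_mul_radialBumpSlope_le {u : E3 → ℝ} (hu : Continuous u)
    (hf : Integrable fun x => exp (3 * u x)) {R : ℝ} (hR : 1 ≤ R) :
    ∫ x, u (R • x) * radialBumpSlope x ≤ 2 * ∫ x, exp (3 * u x) := by
  have hR0 : 0 < R := one_pos.trans_le hR
  calc ∫ x, u (R • x) * radialBumpSlope x ≤ ∫ x, 2 * exp (3 * u (R • x)) := by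
        refine integral_mono (integrable_mul_radialBumpSlope
          (hu.comp (continuous_const_smul R))) ((hf.comp_smul hR0.ne').const_mul 2) fun x => ?_
        have h1 := add_one_le_exp (3 * u (R • x))
        have h2 := radialBumpSlope_nonneg x
        have h3 := radialBumpSlope_le x
        have h4 := exp_pos (3 * u (R • x))
        simp only
        nlinarith [mul_nonneg h2 (sub_nonneg.2 h1)]
    _ = 2 * ((R ^ 3)⁻¹ * ∫ x, exp (3 * u x)) := by
        rw [integral_const_mul, Measure.integral_comp_smul volume (fun x => exp (3 * u x)) R]
        simp [abs_of_pos hR0]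
    _ ≤ _ := by
        gcongr
        exact mul_le_of_le_one_left (integral_nonneg fun x => (exp_pos _).le)
          (inv_le_one_of_one_le₀ (one_le_pow₀ hR))

theorem nonneg_of_neg_lap_eq_potential_add {u : E3 → ℝ} (hu : ContDiff ℝ 2 u)
    (hf : Integrable fun x => exp (3 * u x)) {c a : ℝ} (hc : 0 ≤ c)
    (h : ∀ x, -lap u x = c * (∫ y, exp (3 * u y) * (‖x - y‖ ^ 2)⁻¹) + a) : 0 ≤ a := by
  by_contra! ha
  have hfc : Continuous fun x => exp (3 * u x) := by fun_prop
  obtain ⟨C, hC, hpot⟩ := exists_integral_potential_mul_radialBump_le hfc hf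
    fun y => (exp_pos (3 * u y)).le
  set m : ℝ → ℝ := fun R => ∫ x, u (R • x) * radialBumpSlope x
  set b := -a * ∫ x, radialBump x
  have hb : 0 < b := mul_pos (neg_pos.2 ha) integral_radialBump_pos
  have hderiv : ∀ R, 0 < R → b * R - c * C / R ≤ deriv m R := by
    intro R hR
    obtain ⟨hi, hle⟩ := hpot R hR
    rw [(hasDerivAt_integral_dilation hu R).deriv, integral_fderiv_dilation hu]
    have heq : ∫ x, lap u (R • x) * radialBump x =
        b - c * ∫ x, (∫ y, exp (3 * u y) * (‖R • x - y‖ ^ 2)⁻¹) * radialBump x := by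
      rw [← integral_const_mul c,
        show b = ∫ x, -a * radialBump x from (integral_const_mul _ _).symm,
        ← integral_sub (integrable_radialBump.const_mul _) (hi.const_mul _)]
      congr 1 with x
      rw [← neg_neg (lap u (R • x)), h]
      ring
    rw [heq]
    calc b * R - c * C / R = R * (b - c * (C / R ^ 2)) := by field_simp
      _ ≤ _ := by gcongr
  obtain ⟨R₀, hR₀1, hR₀⟩ : ∃ R₀, 1 ≤ R₀ ∧ ∀ R, R₀ ≤ R → 1 ≤ deriv m R := by
    refine ⟨max 1 ((c * C + 1) / b), le_max_left _ _, fun R hR => ?_⟩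
    have h1 : 1 ≤ R := (le_max_left _ _).trans hR
    have h2 : c * C + 1 ≤ R * b := (div_le_iff₀ hb).1 ((le_max_right _ _).trans hR)
    have h3 : c * C / R ≤ c * C := div_le_self (mul_nonneg hc hC) h1
    linarith [hderiv R (one_pos.trans_le h1)]
  have hdiff : Differentiable ℝ m := fun R => (hasDerivAt_integral_dilation hu R).differentiableAt
  have hgrow : ∀ R, R₀ ≤ R → 1 * (R - R₀) ≤ m R - m R₀ := fun R hR =>
    (convex_Ici R₀).mul_sub_le_image_sub_of_le_deriv hdiff.continuous.continuousOn
      hdiff.differentiableOn (fun y hy => hR₀ y (interior_subset hy)) R₀ Set.self_mem_Ici R hR hR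
  set M := 2 * ∫ x, exp (3 * u x)
  have h1 := hgrow (R₀ + |M - m R₀| + 1) (by linarith [abs_nonneg (M - m R₀)])
  have h2 : m (R₀ + |M - m R₀| + 1) ≤ M :=
    integral_dilation_mul_radialBumpSlope_le hu.continuous hf (by linarith [abs_nonneg (M - m R₀)])
  linarith [le_abs_self (M - m R₀)]

theorem weightedIntegrable_of_memL12 {w : E3 → ℝ} (hwc : Continuous w) (hw : MemL12 w) :
    WeightedIntegrable w := by
  refine hw.2.mono' (Continuous.aestronglyMeasurable ?_) (Eventually.of_forall fun x => ?_)
  · exact hwc.mul (Continuous.inv₀ (by fun_prop) fun x => by positivity)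
  · rw [norm_mul, Real.norm_eq_abs, div_eq_mul_inv, Real.norm_of_nonneg (by positivity)]
    gcongr
    nlinarith [sq_nonneg ‖x‖]

/-- Theorem 11 (integral representation of `−Δu`): for a smooth finite-volume solution
`u` of `(−Δ)^{3/2}u = 2e^{3u}` there is a constant `a ≥ 0` such that
`−Δu(x) = (1/π²)∫ e^{3u(y)}/|x−y|² dy + a` for every `x`. -/
theorem neg_laplacian_integral_representation (u : E3 → ℝ) (hu : IsSolution u) :
    ∃ a : ℝ, 0 ≤ a ∧ ∀ x : E3,
      -(lap u x) = (1 / Real.pi ^ 2) * (∫ y, Real.exp (3 * u y) / ‖x - y‖ ^ 2) + a := by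
  obtain ⟨hsmooth, hmem, hf, heq⟩ := hu
  have hu2 : ContDiff ℝ 2 u := hsmooth.of_le (WithTop.coe_le_coe.2 le_top)
  have hlap := continuous_lap hu2
  have hfc : Continuous fun x => exp (3 * u x) := by
    have := hu2.continuous
    fun_prop
  have hπ : π ^ (3 / 2 : ℝ) * π ^ (3 / 2 : ℝ) = π ^ 3 := by
    rw [← rpow_add pi_pos]
    norm_num
  have hdiff := fun x => neg_lap_sub_eq (w := fun x => -lap u x)
    (κ := 1 / π ^ 2 * π ^ (3 / 2 : ℝ)) ((weightedIntegrable_of_memL12 hlap hmem).neg.congr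
      (Eventually.of_forall fun x => (neg_mul _ _).symm)) hlap.neg hf hfc (fun r hr x₀ => by
      have h := heq (gaussSchwartz r hr x₀)
      simp_rw [halfLap_gaussSchwartz, gaussSchwartz_apply] at h
      have h' : ∫ x, -lap u x * (1 / π ^ 2 * (2 * π ^ (3 / 2 : ℝ) * halfProfile (‖x₀ - x‖ ^ 2) r)) =
          2 * (1 / π ^ 2 * π ^ (3 / 2 : ℝ) * ∫ x, -lap u x * halfProfile (‖x₀ - x‖ ^ 2) r) := by
        rw [← integral_const_mul, ← integral_const_mul]
        congr 1 with x
        ring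
      linarith) x 0
  have hrep : ∀ x, -lap u x = 1 / π ^ 2 * (∫ y, exp (3 * u y) * (‖x - y‖ ^ 2)⁻¹) +
      (-lap u 0 - 1 / π ^ 2 * ∫ y, exp (3 * u y) * (‖0 - y‖ ^ 2)⁻¹) := fun x => by
    have h1 : 1 / π ^ 2 * π ^ (3 / 2 : ℝ) * π *
        (π ^ (3 / 2 : ℝ) * -lap u x - π ^ (3 / 2 : ℝ) * -lap u 0) =
        π ^ 2 * (-lap u x - -lap u 0) := by
      calc _ = 1 / π ^ 2 * π * (π ^ (3 / 2 : ℝ) * π ^ (3 / 2 : ℝ)) * (-lap u x - -lap u 0) := by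
            ring
        _ = _ := by rw [hπ]; field_simp
    have h2 := hdiff x
    rw [h1, mul_comm, ← eq_div_iff (by positivity)] at h2
    linear_combination h2
  exact ⟨_, nonneg_of_neg_lap_eq_potential_add hu2 hf (by positivity) hrep,
    by simpa only [div_eq_mul_inv] using hrep⟩
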